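/- arXiv:2409.03699 — 2 statements merged into one kernel-verified Lean document; each statement's English description precedes it below -/
import Mathlib

section
/- For every integer k ≥ 48, the supremum of the set of densities d(P) over all palettes P that are not admitted by the k-star S_k equals (k² − 5k + 7)/(k − 1)². -/
/-- A palette: a finite nonempty set of colors together with a set of
admissible ordered triples of colors. -/
structure Palette (α : Type) [DecidableEq α] where
  colors : Finset α
  nonempty : colors.Nonempty
  triples : Finset (α × α × α)
  triples_sub : triples ⊆ colors ×ˢ colors ×ˢ colors

/-- The density of a palette: `|A| / |C|³`. -/
noncomputable def Palette.density {α : Type} [DecidableEq α] (P : Palette α) : ℝ :=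
  (P.triples.card : ℝ) / (P.colors.card : ℝ) ^ 3

/-- A 3-graph, given by its edge set `E` on vertex type `V`, admits the palette `P`
if there are a linear (strict total) order on the vertices and a coloring of the
unordered pairs of vertices such that every edge, listed in increasing order,
receives an admissible triple. -/
def Palette.Admits {α : Type} [DecidableEq α] {V : Type} [DecidableEq V]
    (P : Palette α) (E : Set (Finset V)) : Prop :=
  ∃ r : V → V → Prop, IsStrictTotalOrder V r ∧
    ∃ φ : Sym2 V → α, (∀ p, φ p ∈ P.colors) ∧
      ∀ u v w : V, r u v → r v w → ({u, v, w} : Finset V) ∈ E →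
        (φ s(u, v), φ s(u, w), φ s(v, w)) ∈ P.triples

/-- The edge set of the `k`-star `S_k`: vertices `0, 1, …, k` where `0` plays the
role of the center `u`, and `i.succ` that of `v_i`; edges are `{u, v_i, v_j}`. -/
def starEdges (k : ℕ) : Set (Finset (Fin (k + 1))) :=
  {e | ∃ i j : Fin k, i ≠ j ∧ e = {0, i.succ, j.succ}}

open Finset

/-- Weighted Caro–Wei bound for transitive tournaments: an irreflexive relation has a
transitive list of length at least the sum of the weights divided by the weights of the
non-in-neighbourhoods. -/
theorem exists_pairwise_list_of_weights {α : Type*} (R : α → α → Prop) [DecidableRel R]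
    (hR : ∀ v, ¬ R v v) (w : α → ℝ) (V : Finset α) (hw : ∀ v ∈ V, 0 < w v) :
    ∃ l : List α, (∀ v ∈ l, v ∈ V) ∧ l.Pairwise R ∧
      ∑ v ∈ V, w v / (∑ u ∈ V with ¬ R u v, w u) ≤ l.length := by
  induction V using Finset.strongInduction with
  | H V ih =>
    rcases V.eq_empty_or_nonempty with rfl | hne
    · exact ⟨[], by simp⟩
    obtain ⟨v, hv, hmin⟩ := V.exists_min_image (fun v => ∑ u ∈ V with ¬ R u v, w u) hne
    have hpos : ∀ x ∈ V, 0 < ∑ u ∈ V with ¬ R u x, w u := fun x hx =>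
      Finset.sum_pos (fun u hu => hw u (Finset.mem_filter.1 hu).1)
        ⟨x, Finset.mem_filter.2 ⟨hx, hR x⟩⟩
    have hss : V.filter (R · v) ⊂ V := Finset.filter_ssubset.2 ⟨v, hv, hR v⟩
    obtain ⟨l, hlV, hlR, hl⟩ := ih _ hss fun x hx => hw x (Finset.mem_filter.1 hx).1
    refine ⟨l ++ [v], ?_, ?_, ?_⟩
    · intro x hx
      rcases List.mem_append.1 hx with h | h
      · exact (Finset.mem_filter.1 (hlV x h)).1
      · rwa [List.mem_singleton.1 h]
    · refine List.pairwise_append.2 ⟨hlR, List.pairwise_singleton _ _, fun a ha b hb => ?_⟩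
      rw [List.mem_singleton.1 hb]
      exact (Finset.mem_filter.1 (hlV a ha)).2
    · rw [← Finset.sum_filter_add_sum_filter_not V (R · v)]
      have h1 : ∑ x ∈ V with R x v, w x / (∑ u ∈ V with ¬ R u x, w u) ≤ l.length := by
        refine le_trans (Finset.sum_le_sum fun x hx => ?_) hl
        have hxV := (Finset.mem_filter.1 hx).1
        refine div_le_div_of_nonneg_left (hw x hxV).le ?_ ?_
        · exact Finset.sum_pos (fun u hu => hw u (hss.1 (Finset.mem_filter.1 hu).1))
            ⟨x, Finset.mem_filter.2 ⟨hx, hR x⟩⟩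
        · refine Finset.sum_le_sum_of_subset_of_nonneg
            (Finset.filter_subset_filter _ hss.1) fun u hu _ => ?_
          exact (hw u (Finset.mem_filter.1 hu).1).le
      have h2 : ∑ x ∈ V with ¬ R x v, w x / (∑ u ∈ V with ¬ R u x, w u) ≤ 1 := by
        calc _ ≤ ∑ x ∈ V with ¬ R x v, w x / (∑ u ∈ V with ¬ R u v, w u) := by
              refine Finset.sum_le_sum fun x hx => ?_
              have hxV := (Finset.mem_filter.1 hx).1
              exact div_le_div_of_nonneg_left (hw x hxV).le (hpos v hv) (hmin x hxV)
          _ = 1 := by rw [← Finset.sum_div, div_self (hpos v hv).ne']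
      rw [List.length_append, List.length_singleton]
      push_cast
      linarith

open Classical in
/-- The indicator of the complement of a relation. -/
noncomputable def nonRel {α β : Type*} (R : α → β → Prop) (u : α) (v : β) : ℝ :=
  if R u v then 0 else 1

theorem nonRel_nonneg {α β : Type*} (R : α → β → Prop) (u : α) (v : β) : 0 ≤ nonRel R u v := by
  unfold nonRel; split_ifs <;> norm_num

theorem nonRel_le_one {α β : Type*} (R : α → β → Prop) (u : α) (v : β) : nonRel R u v ≤ 1 := by
  unfold nonRel; split_ifs <;> norm_num

theorem sum_div_nonRel_le {α : Type*} [Fintype α] {R : α → α → Prop} {n : ℕ}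
    (hR : ∀ v, ¬ R v v) (hn : ∀ l : List α, l.Pairwise R → l.length ≤ n)
    (w : α → ℝ) (hw : ∀ v, 0 ≤ w v) :
    ∑ v, w v / (∑ u, w u * nonRel R u v) ≤ n := by
  classical
  obtain ⟨l, -, hl, hle⟩ := exists_pairwise_list_of_weights R hR w
    (Finset.univ.filter (0 < w ·)) (fun v hv => (Finset.mem_filter.1 hv).2)
  refine le_trans (le_of_eq ?_) (hle.trans (Nat.cast_le.2 (hn l hl)))
  rw [Finset.sum_filter]
  refine Finset.sum_congr rfl fun v _ => ?_
  split_ifs with h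
  · congr 1
    rw [Finset.sum_filter, Finset.sum_filter]
    refine Finset.sum_congr rfl fun u _ => ?_
    rcases (hw u).eq_or_lt with h0 | h0
    · simp [← h0]
    · simp [nonRel, h0]
  · rw [le_antisymm (not_lt.1 h) (hw v), zero_div]

theorem sum_div_nonRel_flip_le {α : Type*} [Fintype α] {R : α → α → Prop} {n : ℕ}
    (hR : ∀ v, ¬ R v v) (hn : ∀ l : List α, l.Pairwise R → l.length ≤ n)
    (w : α → ℝ) (hw : ∀ v, 0 ≤ w v) :
    ∑ v, w v / (∑ u, w u * nonRel R v u) ≤ n :=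
  sum_div_nonRel_le (R := fun u v => R v u) hR
    (fun l hl => by simpa using hn l.reverse (List.pairwise_reverse.2 hl)) w hw

/-- The pointwise inequality behind the upper bound. -/
theorem tangent_bound {n p q : ℝ} (hn : 47 ≤ n) (hp : 0 < p) (hq : 0 ≤ q)
    (hp' : p ≤ 9 / n) (hq' : q ≤ 9 / n) :
    3 / n - 9 / (2 * n ^ 2) - (2 / n ^ 2 * (1 - 2 / n)) / (p + q)
      - (1 / (2 * n ^ 2) * (1 - 2 / n)) / p ≤ p - p ^ 2 + (q - q ^ 2) / 2 := by
  have hn0 : 0 < n := by linarith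
  obtain ⟨P, rfl⟩ : ∃ P, p = P / n := ⟨p * n, by field_simp⟩
  obtain ⟨Q, rfl⟩ : ∃ Q, q = Q / n := ⟨q * n, by field_simp⟩
  have hP : 0 < P := by simpa [hn0] using hp
  have hQ : 0 ≤ Q := by
    have := mul_nonneg hq hn0.le
    rwa [div_mul_cancel₀ _ hn0.ne'] at this
  have hP9 : P ≤ 9 := (div_le_div_iff_of_pos_right hn0).1 hp'
  have hQ9 : Q ≤ 9 := (div_le_div_iff_of_pos_right hn0).1 hq'
  have hs : 0 < P + Q := by linarith
  have h1 : (P + Q - 2) ^ 2 ≤ (n / 2 - 1) * ((P + Q - 2) ^ 2 / (P + Q)) := by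
    rw [mul_div_assoc', le_div_iff₀ hs, mul_comm]
    gcongr
    linarith
  have h2 : 2 * (P - 1) ^ 2 ≤ (n / 2 - 1) * ((P - 1) ^ 2 / P) := by
    rw [mul_div_assoc', le_div_iff₀ hP]
    nlinarith [sq_nonneg (P - 1),
      mul_nonneg (sq_nonneg (P - 1)) (by linarith : 0 ≤ n / 2 - 1 - 2 * P)]
  have h3 : (P - 1) ^ 2 + (Q - 1) ^ 2 / 2 ≤ (P + Q - 2) ^ 2 + 2 * (P - 1) ^ 2 := by
    nlinarith [sq_nonneg (P + Q - 2 + (P - 1))]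
  have key : (P / n - (P / n) ^ 2 + (Q / n - (Q / n) ^ 2) / 2)
      - (3 / n - 9 / (2 * n ^ 2) - (2 / n ^ 2 * (1 - 2 / n)) / (P / n + Q / n)
      - (1 / (2 * n ^ 2) * (1 - 2 / n)) / (P / n))
      = ((n / 2 - 1) * ((P + Q - 2) ^ 2 / (P + Q)) + (n / 2 - 1) * ((P - 1) ^ 2 / P)
        - ((P - 1) ^ 2 + (Q - 1) ^ 2 / 2)) / n ^ 2 := by
    have : P / n + Q / n = (P + Q) / n := by ring
    rw [this]
    field_simp
    ring
  have : 0 ≤ ((n / 2 - 1) * ((P + Q - 2) ^ 2 / (P + Q)) + (n / 2 - 1) * ((P - 1) ^ 2 / P)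
        - ((P - 1) ^ 2 + (Q - 1) ^ 2 / 2)) / n ^ 2 := by
    apply div_nonneg _ (by positivity)
    linarith
  linarith

/-- The density of a weighted ternary kernel. -/
def tripleSum {ι : Type*} [Fintype ι] (I : ι → ι → ι → ℝ) (w : ι → ℝ) : ℝ :=
  ∑ a, ∑ b, ∑ c, I a b c * (w a * w b * w c)

/-- The sum of the densities of the three links of `v` in a weighted ternary kernel. -/
def linkSum {ι : Type*} [Fintype ι] (I : ι → ι → ι → ℝ) (w : ι → ℝ) (v : ι) : ℝ :=
  ∑ b, ∑ c, I v b c * (w b * w c) + ∑ a, ∑ c, I a v c * (w a * w c)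
    + ∑ a, ∑ b, I a b v * (w a * w b)

theorem sum_mul_linkSum {ι : Type*} [Fintype ι] (I : ι → ι → ι → ℝ) (w : ι → ℝ) :
    ∑ v, w v * linkSum I w v = 3 * tripleSum I w := by
  have h1 : ∑ v, w v * ∑ b, ∑ c, I v b c * (w b * w c) = tripleSum I w := by
    simp only [tripleSum, Finset.mul_sum]
    refine sum_congr rfl fun a _ => sum_congr rfl fun b _ => sum_congr rfl fun c _ => ?_
    ring
  have h2 : ∑ v, w v * ∑ a, ∑ c, I a v c * (w a * w c) = tripleSum I w := by
    simp only [tripleSum, Finset.mul_sum]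
    rw [sum_comm]
    refine sum_congr rfl fun a _ => sum_congr rfl fun b _ => sum_congr rfl fun c _ => ?_
    ring
  have h3 : ∑ v, w v * ∑ a, ∑ b, I a b v * (w a * w b) = tripleSum I w := by
    simp only [tripleSum, Finset.mul_sum]
    rw [sum_comm]
    refine sum_congr rfl fun a _ => ?_
    rw [sum_comm]
    refine sum_congr rfl fun b _ => sum_congr rfl fun c _ => ?_
    ring
  simp only [linkSum, mul_add, sum_add_distrib, h1, h2, h3]
  ring

theorem linkSum_eq_tripleSums {ι : Type*} [Fintype ι] [DecidableEq ι] (I : ι → ι → ι → ℝ)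
    (w : ι → ℝ) (v : ι) :
    linkSum I w v = ∑ a, ∑ b, ∑ c, I a b c *
      ((Pi.single v 1 : ι → ℝ) a * w b * w c + w a * (Pi.single v 1 : ι → ℝ) b * w c
        + w a * w b * (Pi.single v 1 : ι → ℝ) c) := by
  have h1 : ∑ a, ∑ b, ∑ c, I a b c * ((Pi.single v 1 : ι → ℝ) a * w b * w c)
      = ∑ b, ∑ c, I v b c * (w b * w c) := by
    rw [Finset.sum_eq_single v]
    · simp
    · intro a _ ha
      simp [ha]
    · simp
  have h2 : ∑ a, ∑ b, ∑ c, I a b c * (w a * (Pi.single v 1 : ι → ℝ) b * w c)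
      = ∑ a, ∑ c, I a v c * (w a * w c) := by
    refine sum_congr rfl fun a _ => ?_
    rw [Finset.sum_eq_single v]
    · simp
    · intro b _ hb
      simp [hb]
    · simp
  have h3 : ∑ a, ∑ b, ∑ c, I a b c * (w a * w b * (Pi.single v 1 : ι → ℝ) c)
      = ∑ a, ∑ b, I a b v * (w a * w b) := by
    refine sum_congr rfl fun a _ => sum_congr rfl fun b _ => ?_
    rw [Finset.sum_eq_single v]
    · simp
    · intro c _ hc
      simp [hc]
    · simp
  simp only [mul_add, sum_add_distrib, h1, h2, h3, linkSum]

theorem linkSum_le_of_isMaxOn {ι : Type*} [Fintype ι] {I : ι → ι → ι → ℝ}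
    (hI : ∀ a b c, 0 ≤ I a b c) {w : ι → ℝ} (hw : w ∈ stdSimplex ℝ ι)
    (hmax : IsMaxOn (tripleSum I) (stdSimplex ℝ ι) w) (v : ι) :
    linkSum I w v ≤ 3 * tripleSum I w := by
  classical
  set e : ι → ℝ := Pi.single v 1 with he
  have hee : e ∈ stdSimplex ℝ ι := single_mem_stdSimplex ℝ v
  have hexp : ∀ t : ℝ, 0 < t → t < 1 →
      (1 - t) ^ 2 * linkSum I w v ≤ (3 - 3 * t + t ^ 2) * tripleSum I w := by
    intro t h0 h1
    have hmem : (1 - t) • w + t • e ∈ stdSimplex ℝ ι :=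
      convex_stdSimplex ℝ ι hw hee (by linarith) h0.le (by ring)
    have hle : tripleSum I ((1 - t) • w + t • e) ≤ tripleSum I w := hmax hmem
    have hge : (1 - t) ^ 3 * tripleSum I w + (1 - t) ^ 2 * t * linkSum I w v
        ≤ tripleSum I ((1 - t) • w + t • e) := by
      rw [linkSum_eq_tripleSums, ← he]
      simp only [tripleSum, mul_sum, ← sum_add_distrib]
      refine sum_le_sum fun a _ => sum_le_sum fun b _ => sum_le_sum fun c _ => ?_
      simp only [Pi.add_apply, Pi.smul_apply, smul_eq_mul]
      have hr : 0 ≤ I a b c * ((1 - t) * t ^ 2 * (w a * e b * e c + e a * w b * e c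
          + e a * e b * w c) + t ^ 3 * (e a * e b * e c)) := by
        have hs : 0 ≤ 1 - t := by linarith
        have := hI a b c
        have := hw.1 a
        have := hw.1 b
        have := hw.1 c
        have := hee.1 a
        have := hee.1 b
        have := hee.1 c
        positivity
      linarith
    have : t * ((1 - t) ^ 2 * linkSum I w v) ≤ t * ((3 - 3 * t + t ^ 2) * tripleSum I w) := by
      linarith
    exact le_of_mul_le_mul_left this h0
  have hl : Filter.Tendsto (fun t : ℝ => (1 - t) ^ 2 * linkSum I w v)
      (nhdsWithin 0 (Set.Ioi 0)) (nhds (linkSum I w v)) := by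
    have : Continuous fun t : ℝ => (1 - t) ^ 2 * linkSum I w v := by fun_prop
    simpa using (this.tendsto 0).mono_left nhdsWithin_le_nhds
  have hr : Filter.Tendsto (fun t : ℝ => (3 - 3 * t + t ^ 2) * tripleSum I w)
      (nhdsWithin 0 (Set.Ioi 0)) (nhds (3 * tripleSum I w)) := by
    have : Continuous fun t : ℝ => (3 - 3 * t + t ^ 2) * tripleSum I w := by fun_prop
    simpa using (this.tendsto 0).mono_left nhdsWithin_le_nhds
  refine le_of_tendsto_of_tendsto hl hr ?_
  filter_upwards [Ioo_mem_nhdsGT (zero_lt_one' ℝ)] with t ht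
  exact hexp t ht.1 ht.2

/-- Optimal weights exist, and all links of positive weight vertices are then equally dense. -/
theorem exists_optimal_weights {ι : Type*} [Fintype ι] [Nonempty ι] {I : ι → ι → ι → ℝ}
    (hI : ∀ a b c, 0 ≤ I a b c) :
    ∃ w ∈ stdSimplex ℝ ι, IsMaxOn (tripleSum I) (stdSimplex ℝ ι) w ∧
      ∀ v, 0 < w v → linkSum I w v = 3 * tripleSum I w := by
  classical
  have hc : Continuous (tripleSum I) := by unfold tripleSum; fun_prop
  obtain ⟨w, hw, hmax⟩ := (isCompact_stdSimplex ℝ ι).exists_isMaxOn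
    ⟨_, single_mem_stdSimplex ℝ (Classical.arbitrary ι)⟩ hc.continuousOn
  refine ⟨w, hw, hmax, fun v hv => ?_⟩
  have hsum : ∑ v, w v * (3 * tripleSum I w - linkSum I w v) = 0 := by
    simp only [mul_sub, sum_sub_distrib, sum_mul_linkSum, ← sum_mul, hw.2]
    ring
  have hz := (sum_eq_zero_iff_of_nonneg fun u _ => mul_nonneg (hw.1 u)
    (sub_nonneg.2 (linkSum_le_of_isMaxOn hI hw hmax u))).1 hsum v (mem_univ v)
  rcases mul_eq_zero.1 hz with h | h
  · exact absurd h hv.ne'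
  · linarith

/-- The weighted in-degree of `v`. -/
def inWeight {ι : Type*} [Fintype ι] (w : ι → ℝ) (x : ι → ι → ℝ) (v : ι) : ℝ :=
  ∑ u, w u * x u v

/-- The weighted out-degree of `v`. -/
def outWeight {ι : Type*} [Fintype ι] (w : ι → ℝ) (x : ι → ι → ℝ) (v : ι) : ℝ :=
  ∑ u, w u * x v u

theorem sum_mul_inWeight {ι : Type*} [Fintype ι] (w : ι → ℝ) (x : ι → ι → ℝ) :
    ∑ v, w v * inWeight w x v = ∑ v, w v * outWeight w x v := by
  simp only [inWeight, outWeight, mul_sum]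
  rw [sum_comm]
  refine sum_congr rfl fun a _ => sum_congr rfl fun b _ => ?_
  ring

/-- A Bonferroni inequality for kernels supported on the triples that avoid three relations. -/
theorem tripleSum_le_of_bonferroni {ι : Type*} [Fintype ι] {I : ι → ι → ι → ℝ}
    {x y z : ι → ι → ℝ} {w : ι → ℝ} (hw : w ∈ stdSimplex ℝ ι)
    (hI : ∀ a b c, I a b c ≤ 1 - x b c - y a c - z a b + x b c * y a c + x b c * z a b
      + y a c * z a b) :
    tripleSum I w ≤ 1 - (∑ v, w v *
      ((inWeight w x v - inWeight w x v ^ 2) + (outWeight w x v - outWeight w x v ^ 2)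
      + (inWeight w y v - inWeight w y v ^ 2) + (outWeight w y v - outWeight w y v ^ 2)
      + (inWeight w z v - inWeight w z v ^ 2) + (outWeight w z v - outWeight w z v ^ 2))) / 2 := by
  have hw1 : ∑ v, w v = 1 := hw.2
  have h0 : ∑ a, ∑ b, ∑ c, w a * w b * w c = 1 := by
    simp only [← mul_sum, hw1, mul_one]
  have hx : ∑ a, ∑ b, ∑ c, w a * w b * w c * x b c = ∑ v, w v * outWeight w x v := by
    simp only [outWeight, mul_assoc, ← mul_sum]
    rw [← sum_mul, hw1, one_mul]
  have hy : ∑ a, ∑ b, ∑ c, w a * w b * w c * y a c = ∑ v, w v * outWeight w y v := by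
    simp only [outWeight, mul_assoc, ← mul_sum]
    refine sum_congr rfl fun a _ => ?_
    rw [← sum_mul, hw1, one_mul]
  have hz : ∑ a, ∑ b, ∑ c, w a * w b * w c * z a b = ∑ v, w v * outWeight w z v := by
    simp only [outWeight, mul_assoc, ← mul_sum, ← sum_mul, hw1, one_mul]
  have hxy : ∑ a, ∑ b, ∑ c, w a * w b * w c * (x b c * y a c)
      = ∑ v, w v * (inWeight w x v * inWeight w y v) := by
    have : ∀ a, ∑ b, ∑ c, w a * w b * w c * (x b c * y a c)
        = ∑ c, ∑ b, w a * w b * w c * (x b c * y a c) := fun a => sum_comm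
    simp only [this]
    rw [sum_comm]
    refine sum_congr rfl fun c _ => ?_
    rw [inWeight, inWeight, mul_comm (∑ u, _), sum_mul_sum, mul_sum]
    refine sum_congr rfl fun a _ => ?_
    rw [mul_sum]
    refine sum_congr rfl fun b _ => ?_
    ring
  have hxz : ∑ a, ∑ b, ∑ c, w a * w b * w c * (x b c * z a b)
      = ∑ v, w v * (outWeight w x v * inWeight w z v) := by
    rw [sum_comm]
    refine sum_congr rfl fun b _ => ?_
    rw [inWeight, outWeight, mul_comm (∑ u, _), sum_mul_sum, mul_sum]
    refine sum_congr rfl fun a _ => ?_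
    rw [mul_sum]
    refine sum_congr rfl fun c _ => ?_
    ring
  have hyz : ∑ a, ∑ b, ∑ c, w a * w b * w c * (y a c * z a b)
      = ∑ v, w v * (outWeight w y v * outWeight w z v) := by
    refine sum_congr rfl fun a _ => ?_
    rw [outWeight, outWeight, mul_comm (∑ u, _), sum_mul_sum, mul_sum]
    refine sum_congr rfl fun b _ => ?_
    rw [mul_sum]
    refine sum_congr rfl fun c _ => ?_
    ring
  have hT : tripleSum I w ≤ ∑ a, ∑ b, ∑ c, (w a * w b * w c - w a * w b * w c * x b c
      - w a * w b * w c * y a c - w a * w b * w c * z a b + w a * w b * w c * (x b c * y a c)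
      + w a * w b * w c * (x b c * z a b) + w a * w b * w c * (y a c * z a b)) := by
    refine sum_le_sum fun a _ => sum_le_sum fun b _ => sum_le_sum fun c _ => ?_
    have := mul_le_mul_of_nonneg_right (hI a b c)
      (mul_nonneg (mul_nonneg (hw.1 a) (hw.1 b)) (hw.1 c))
    linarith
  simp only [sum_add_distrib, sum_sub_distrib, h0, hx, hy, hz, hxy, hxz, hyz] at hT
  have amgm : ∀ f g : ι → ℝ,
      ∑ v, w v * (f v * g v) ≤ (∑ v, w v * f v ^ 2 + ∑ v, w v * g v ^ 2) / 2 := by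
    intro f g
    rw [← sum_add_distrib, sum_div]
    refine sum_le_sum fun v _ => ?_
    nlinarith [mul_nonneg (hw.1 v) (sq_nonneg (f v - g v))]
  have h1 := amgm (inWeight w x) (inWeight w y)
  have h2 := amgm (outWeight w x) (inWeight w z)
  have h3 := amgm (outWeight w y) (outWeight w z)
  simp only [mul_add, mul_sub, sum_add_distrib, sum_sub_distrib, sum_mul_inWeight]
  linarith

theorem sum_sum_mul_le_one_sub {ι : Type*} [Fintype ι] {w f : ι → ℝ} {J : ι → ι → ℝ}
    (hw : w ∈ stdSimplex ℝ ι) (hJ : ∀ a b, J a b ≤ 1 - f a) :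
    ∑ a, ∑ b, J a b * (w a * w b) ≤ 1 - ∑ a, w a * f a := by
  have : ∑ a, ∑ b, J a b * (w a * w b) ≤ ∑ a, ∑ b, (w a - w a * f a) * w b := by
    refine sum_le_sum fun a _ => sum_le_sum fun b _ => ?_
    have := mul_le_mul_of_nonneg_right (hJ a b) (mul_nonneg (hw.1 a) (hw.1 b))
    linarith
  have hw1 : ∑ v, w v = 1 := hw.2
  simpa only [← mul_sum, hw1, mul_one, sum_sub_distrib] using this

theorem sum_sum_mul_le_one_sub' {ι : Type*} [Fintype ι] {w f : ι → ℝ} {J : ι → ι → ℝ}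
    (hw : w ∈ stdSimplex ℝ ι) (hJ : ∀ a b, J a b ≤ 1 - f b) :
    ∑ a, ∑ b, J a b * (w a * w b) ≤ 1 - ∑ b, w b * f b := by
  rw [sum_comm]
  simpa only [mul_comm (w _) (w _)] using
    sum_sum_mul_le_one_sub (J := fun a b => J b a) hw fun a b => hJ b a

/-- Each degree of a vertex in the avoided relations is at most the deficiency of its links. -/
theorem weights_le_of_linkSum {ι : Type*} [Fintype ι] {I : ι → ι → ι → ℝ}
    {x y z : ι → ι → ℝ} {w : ι → ℝ} (hw : w ∈ stdSimplex ℝ ι)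
    (hx0 : ∀ a b, 0 ≤ x a b) (hy0 : ∀ a b, 0 ≤ y a b)
    (hx : ∀ a b c, I a b c ≤ 1 - x b c) (hy : ∀ a b c, I a b c ≤ 1 - y a c)
    (hz : ∀ a b c, I a b c ≤ 1 - z a b) (v : ι) :
    inWeight w x v ≤ 3 - linkSum I w v ∧ outWeight w x v ≤ 3 - linkSum I w v ∧
    inWeight w y v ≤ 3 - linkSum I w v ∧ outWeight w y v ≤ 3 - linkSum I w v ∧
    inWeight w z v ≤ 3 - linkSum I w v ∧ outWeight w z v ≤ 3 - linkSum I w v := by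
  have a1 := sum_sum_mul_le_one_sub' (J := fun b c => I v b c) hw fun b c => hy v b c
  have a2 := sum_sum_mul_le_one_sub (J := fun b c => I v b c) hw fun b c => hz v b c
  have b1 := sum_sum_mul_le_one_sub' (J := fun a c => I a v c) hw fun a c => hx a v c
  have b2 := sum_sum_mul_le_one_sub (J := fun a c => I a v c) hw fun a c => hz a v c
  have c1 := sum_sum_mul_le_one_sub' (J := fun a b => I a b v) hw fun a b => hx a b v
  have c2 := sum_sum_mul_le_one_sub (J := fun a b => I a b v) hw fun a b => hy a b v
  have hnn : ∀ f : ι → ℝ, (∀ a, 0 ≤ f a) → 0 ≤ ∑ a, w a * f a := fun f hf =>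
    sum_nonneg fun a _ => mul_nonneg (hw.1 a) (hf a)
  have n1 := hnn _ fun c => hy0 v c
  have n2 := hnn _ fun c => hx0 v c
  have n3 := hnn _ fun c => hx0 c v
  simp only [linkSum, inWeight, outWeight]
  refine ⟨?_, ?_, ?_, ?_, ?_, ?_⟩ <;> linarith

/-- The compatibility relation on `ι ⊕ ι` of a ternary relation: the two copies of `ι` hold the
colors of the pairs joining the center of a star to a leaf before, respectively after, it. -/
def starRel {ι : Type*} (A : ι → ι → ι → Prop) : ι ⊕ ι → ι ⊕ ι → Prop
  | .inl x, .inl y => ∃ a, A a x y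
  | .inl x, .inr y => ∃ b, A x b y
  | .inr y, .inl x => ∃ b, A x b y
  | .inr x, .inr y => ∃ c, A x y c

open Classical in
/-- The indicator of a ternary relation. -/
noncomputable def tripleInd {ι : Type*} (A : ι → ι → ι → Prop) (a b c : ι) : ℝ :=
  if A a b c then 1 else 0

/-- The sum of two instances of `tangent_bound` with a common `q`, scaled by a weight. -/
theorem weighted_tangent_bound {n w p p' q : ℝ} (hn : 47 ≤ n) (hw : 0 ≤ w)
    (hp : 0 < w → 0 < p) (hp' : 0 < w → 0 < p') (hq : 0 ≤ q) (h9 : 0 < w → p ≤ 9 / n)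
    (h9' : 0 < w → p' ≤ 9 / n) (h9q : 0 < w → q ≤ 9 / n) :
    2 * (3 / n - 9 / (2 * n ^ 2)) * w
      - (2 / n ^ 2 * (1 - 2 / n)) * (w / (p + q) + w / (p' + q))
      - (1 / (2 * n ^ 2) * (1 - 2 / n)) * (w / p + w / p')
      ≤ w * (p - p ^ 2) + w * (p' - p' ^ 2) + w * (q - q ^ 2) := by
  rcases hw.eq_or_lt with rfl | h
  · simp
  have h1 := mul_le_mul_of_nonneg_left (tangent_bound hn (hp h) hq (h9 h) (h9q h)) hw
  have h2 := mul_le_mul_of_nonneg_left (tangent_bound hn (hp' h) hq (h9' h) (h9q h)) hw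
  refine le_trans (le_of_eq ?_) ((add_le_add h1 h2).trans (le_of_eq ?_)) <;> ring

/-- The density bound for ternary relations without long lists of compatible colors. -/
theorem tripleSum_le_of_starRel {ι : Type*} [Fintype ι] [Nonempty ι] {A : ι → ι → ι → Prop}
    {n : ℕ} (hn : 47 ≤ n) (hirr : ∀ v, ¬ starRel A v v)
    (hfree : ∀ l : List (ι ⊕ ι), l.Pairwise (starRel A) → l.length ≤ n)
    {u : ι → ℝ} (hu : u ∈ stdSimplex ℝ ι) :
    tripleSum (tripleInd A) u ≤ 1 - 3 / n + 3 / (n : ℝ) ^ 2 := by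
  have hn' : (47 : ℝ) ≤ n := by exact_mod_cast hn
  obtain ⟨w, hw, hmax, hlink⟩ := exists_optimal_weights (I := tripleInd A)
    fun a b c => by unfold tripleInd; split_ifs <;> norm_num
  refine (hmax hu).trans ?_
  change tripleSum (tripleInd A) w ≤ _
  set T := tripleSum (tripleInd A) w with hT
  by_contra! hlt
  set x := nonRel fun b c => ∃ a, A a b c with hxdef
  set y := nonRel fun a c => ∃ b, A a b c
  set z := nonRel fun a b => ∃ c, A a b c
  have hx0 : ∀ a b, 0 ≤ x a b := nonRel_nonneg _
  have hy0 : ∀ a b, 0 ≤ y a b := nonRel_nonneg _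
  have hz0 : ∀ a b, 0 ≤ z a b := nonRel_nonneg _
  have hIxyz : ∀ a b c, A a b c → x b c = 0 ∧ y a c = 0 ∧ z a b = 0 := fun a b c h =>
    ⟨if_pos ⟨a, h⟩, if_pos ⟨b, h⟩, if_pos ⟨c, h⟩⟩
  have hx1 : ∀ a b, x a b ≤ 1 := nonRel_le_one _
  have hy1 : ∀ a b, y a b ≤ 1 := nonRel_le_one _
  have hz1 : ∀ a b, z a b ≤ 1 := nonRel_le_one _
  have hB := tripleSum_le_of_bonferroni (I := tripleInd A) (x := x) (y := y) (z := z) hw (by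
    intro a b c
    unfold tripleInd
    split_ifs with h
    · obtain ⟨h1, h2, h3⟩ := hIxyz a b c h
      simp [h1, h2, h3]
    · have h1 : x b c = 0 ∨ x b c = 1 := by simp only [hxdef, nonRel]; split_ifs <;> simp
      rcases h1 with h1 | h1 <;> rw [h1] <;>
        nlinarith [hy0 a c, hy1 a c, hz0 a b, hz1 a b,
          mul_nonneg (sub_nonneg.2 (hy1 a c)) (sub_nonneg.2 (hz1 a b)),
          mul_nonneg (hy0 a c) (hz0 a b)])
  have hle := weights_le_of_linkSum (I := tripleInd A) (x := x) (y := y) (z := z) hw hx0 hy0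
    (fun a b c => by
      unfold tripleInd; split_ifs with h
      · simp [(hIxyz a b c h).1]
      · linarith [hx1 b c])
    (fun a b c => by
      unfold tripleInd; split_ifs with h
      · simp [(hIxyz a b c h).2.1]
      · linarith [hy1 a c])
    (fun a b c => by
      unfold tripleInd; split_ifs with h
      · simp [(hIxyz a b c h).2.2]
      · linarith [hz1 a b])
  have hnine : ∀ v, 0 < w v → 3 - linkSum (tripleInd A) w v ≤ 9 / n := by
    intro v hv
    have h1 : 0 ≤ 3 / (n : ℝ) ^ 2 := by positivity
    have h2 : (9 : ℝ) / n = 3 * (3 / n) := by ring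
    rw [hlink v hv, h2]
    linarith
  have hin : ∀ t : ι → ι → ℝ, (∀ a b, 0 ≤ t a b) → (∀ a, t a a = 1) → ∀ v, 0 < w v →
      0 < inWeight w t v ∧ 0 < outWeight w t v := by
    intro t ht ht1 v hv
    constructor <;>
    · refine sum_pos' (fun a _ => mul_nonneg (hw.1 a) (ht _ _)) ⟨v, mem_univ v, ?_⟩
      rwa [ht1, mul_one]
  have hxpos := hin x hx0 fun a => if_neg (hirr (.inl a))
  have hzpos := hin z hz0 fun a => if_neg (hirr (.inr a))
  have hyin : ∀ v, 0 ≤ inWeight w y v := fun v =>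
    sum_nonneg fun a _ => mul_nonneg (hw.1 a) (hy0 _ _)
  have hyout : ∀ v, 0 ≤ outWeight w y v := fun v =>
    sum_nonneg fun a _ => mul_nonneg (hw.1 a) (hy0 _ _)
  have hx := fun v => weighted_tangent_bound hn' (hw.1 v) (fun h => (hxpos v h).1)
    (fun h => (hxpos v h).2) (hyout v) (fun h => (hle v).1.trans (hnine v h))
    (fun h => (hle v).2.1.trans (hnine v h)) (fun h => (hle v).2.2.2.1.trans (hnine v h))
  have hz := fun v => weighted_tangent_bound hn' (hw.1 v) (fun h => (hzpos v h).1)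
    (fun h => (hzpos v h).2) (hyin v) (fun h => (hle v).2.2.2.2.1.trans (hnine v h))
    (fun h => (hle v).2.2.2.2.2.trans (hnine v h)) (fun h => (hle v).2.2.1.trans (hnine v h))
  have hsx := sum_le_sum fun v (_ : v ∈ univ) => hx v
  have hsz := sum_le_sum fun v (_ : v ∈ univ) => hz v
  have hw1 : ∑ v, w v = 1 := hw.2
  have e1 : ∀ v u, nonRel (starRel A) (.inl v) (.inl u) = x v u := fun _ _ => rfl
  have e2 : ∀ v u, nonRel (starRel A) (.inl v) (.inr u) = y v u := fun _ _ => rfl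
  have e3 : ∀ v u, nonRel (starRel A) (.inr v) (.inl u) = y u v := fun _ _ => rfl
  have e4 : ∀ v u, nonRel (starRel A) (.inr v) (.inr u) = z v u := fun _ _ => rfl
  have both : ∀ v : ι ⊕ ι, 0 ≤ Sum.elim w w v := by rintro (v | v) <;> exact hw.1 v
  have left : ∀ v : ι ⊕ ι, 0 ≤ Sum.elim w (0 : ι → ℝ) v := by
    rintro (v | v) <;> simp [hw.1 v]
  have right : ∀ v : ι ⊕ ι, 0 ≤ Sum.elim (0 : ι → ℝ) w v := by
    rintro (v | v) <;> simp [hw.1 v]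
  have b1 := sum_div_nonRel_le hirr hfree _ both
  have b2 := sum_div_nonRel_flip_le hirr hfree _ both
  have l1 := sum_div_nonRel_le hirr hfree _ left
  have l2 := sum_div_nonRel_flip_le hirr hfree _ left
  have r1 := sum_div_nonRel_le hirr hfree _ right
  have r2 := sum_div_nonRel_flip_le hirr hfree _ right
  simp only [Fintype.sum_sum_type, Sum.elim_inl, Sum.elim_inr, e1, e2, e3, e4, Pi.zero_apply,
    zero_mul, zero_div, sum_const_zero, add_zero, zero_add]
    at b1 b2 l1 l2 r1 r2
  simp only [← inWeight.eq_1, ← outWeight.eq_1, add_comm (inWeight w y _)] at b1 b2 l1 l2 r1 r2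
  have hβ : 0 ≤ 2 / (n : ℝ) ^ 2 * (1 - 2 / n) := by
    have : 2 / (n : ℝ) ≤ 1 := by rw [div_le_one (by linarith)]; linarith
    exact mul_nonneg (by positivity) (by linarith)
  have hγ : 0 ≤ 1 / (2 * (n : ℝ) ^ 2) * (1 - 2 / n) := by
    have : 1 / (2 * (n : ℝ) ^ 2) * (1 - 2 / n) = 2 / (n : ℝ) ^ 2 * (1 - 2 / n) / 4 := by
      ring
    linarith
  have hjoint := mul_le_mul_of_nonneg_left (add_le_add b1 b2) hβ
  have hsingle := mul_le_mul_of_nonneg_left (add_le_add (add_le_add l1 l2) (add_le_add r1 r2)) hγ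
  have hval : 2 * (2 * (3 / (n : ℝ) - 9 / (2 * (n : ℝ) ^ 2)))
      - 2 / (n : ℝ) ^ 2 * (1 - 2 / n) * (n + n)
      - 1 / (2 * (n : ℝ) ^ 2) * (1 - 2 / n) * (n + n + (n + n))
      = 2 * (3 / n - 3 / (n : ℝ) ^ 2) := by
    have : (n : ℝ) ≠ 0 := by linarith
    field_simp
    ring
  simp only [sum_add_distrib, sum_sub_distrib, ← mul_sum, hw1, mul_one] at hsx hsz
  simp only [mul_add, sum_add_distrib] at hB hjoint hsingle hsx hsz
  rw [← hT] at hB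
  linarith

/-- The relation between the colors of two pairs at the center of a star and the color `t` of
the third pair of their edge. -/
def starWitness {ι : Type*} (A : ι → ι → ι → Prop) (t : ι) : ι ⊕ ι → ι ⊕ ι → Prop
  | .inl x, .inl y => A t x y
  | .inl x, .inr y => A x t y
  | .inr _, .inl _ => True
  | .inr x, .inr y => A x y t

theorem starRel.exists_starWitness {ι : Type*} {A : ι → ι → ι → Prop} {x y : ι ⊕ ι}
    (h : starRel A x y) : ∃ t, starWitness A t x y := by
  rcases x with x | x <;> rcases y with y | y
  · exact h
  · exact h
  · exact ⟨x, trivial⟩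
  · exact h

/-- The ternary relation on the colors of a palette. -/
def Palette.Rel (P : Palette ℕ) (a b c : P.colors) : Prop := (a.1, b.1, c.1) ∈ P.triples

theorem Palette.admits_of_pairwise_starRel (P : Palette ℕ) {l : List (P.colors ⊕ P.colors)}
    (hl : l.Pairwise (starRel P.Rel)) : P.Admits (starEdges l.length) := by
  set k := l.length
  set s : Fin k → P.colors ⊕ P.colors := l.get
  have hmono : ∀ i j, i < j → starRel P.Rel (s i) (s j) := fun i j h =>
    List.pairwise_iff_get.1 hl i j h
  set rank : Fin (k + 1) → ℕ := Fin.cases k fun i => if (s i).isLeft then i else k + 1 + i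
  have rank0 : rank 0 = k := rfl
  have rankS : ∀ i : Fin k, rank i.succ = if (s i).isLeft then (i : ℕ) else k + 1 + i :=
    fun i => rfl
  have hinj : Function.Injective rank := by
    intro u v
    refine Fin.cases ?_ (fun i => ?_) u <;> refine Fin.cases ?_ (fun j => ?_) v
    · simp
    · rw [rank0, rankS]
      split_ifs <;> intro h <;> omega
    · rw [rank0, rankS]
      split_ifs <;> intro h <;> omega
    · rw [rankS, rankS, Fin.succ_inj, Fin.ext_iff]
      split_ifs <;> intro h <;> omega
  have hlt : ∀ i j, rank i.succ < rank j.succ → starRel P.Rel (s i) (s j) := by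
    intro i j h
    rw [rankS, rankS] at h
    rcases lt_trichotomy i j with hij | rfl | hij
    · exact hmono i j hij
    · exact absurd h (lt_irrefl _)
    · have := hmono j i hij
      rcases hi : s i with x | x <;> rcases hj : s j with y | y <;> rw [hi, hj] at h this
      · simp only [Sum.isLeft_inl, if_true] at h
        omega
      · exact this
      · exact this
      · simp only [Sum.isLeft_inr, Bool.false_eq_true, if_false] at h
        omega
  have hφ : ∀ p : Sym2 (Fin (k + 1)), ∃ t : P.colors,
      (∀ i : Fin k, p = s(0, i.succ) → t = Sum.elim id id (s i)) ∧
      ∀ i j : Fin k, p = s(i.succ, j.succ) → rank i.succ < rank j.succ →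
        starWitness P.Rel t (s i) (s j) := by
    have hne : Nonempty P.colors := P.nonempty.to_subtype
    intro p
    induction p using Sym2.ind with
    | _ u v =>
      rcases Fin.eq_zero_or_eq_succ u with rfl | ⟨i, rfl⟩ <;>
        rcases Fin.eq_zero_or_eq_succ v with rfl | ⟨j, rfl⟩
      · refine ⟨Classical.arbitrary _, fun i h => ?_, fun i j h => ?_⟩ <;>
          simp [(Fin.succ_ne_zero _).symm] at h
      · refine ⟨Sum.elim id id (s j), fun i h => ?_, fun i j h => ?_⟩
        · simp at h
          rw [h]
        · simp [(Fin.succ_ne_zero _).symm] at h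
      · refine ⟨Sum.elim id id (s i), fun i h => ?_, fun i j h => ?_⟩
        · simp at h
          rw [h]
        · simp [(Fin.succ_ne_zero _).symm] at h
      · rcases lt_trichotomy (rank i.succ) (rank j.succ) with h | h | h
        · obtain ⟨t, ht⟩ := (hlt i j h).exists_starWitness
          refine ⟨t, fun i h => ?_, fun i' j' h' hlt' => ?_⟩
          · simp at h
          · simp only [Sym2.eq_iff, Fin.succ_inj] at h'
            rcases h' with ⟨rfl, rfl⟩ | ⟨rfl, rfl⟩
            · exact ht
            · exact absurd hlt' h.not_gt
        · have := Fin.succ_injective _ (hinj h)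
          subst this
          refine ⟨Classical.arbitrary _, fun i h => ?_, fun i' j' h' hlt' => ?_⟩
          · simp at h
          · simp only [Sym2.eq_iff, Fin.succ_inj] at h'
            rcases h' with ⟨rfl, rfl⟩ | ⟨rfl, rfl⟩ <;> exact absurd hlt' (lt_irrefl _)
        · obtain ⟨t, ht⟩ := (hlt j i h).exists_starWitness
          refine ⟨t, fun i h => ?_, fun i' j' h' hlt' => ?_⟩
          · simp at h
          · simp only [Sym2.eq_iff, Fin.succ_inj] at h'
            rcases h' with ⟨rfl, rfl⟩ | ⟨rfl, rfl⟩
            · exact absurd hlt' h.not_gt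
            · exact ht
  choose φ hcenter hleaf using hφ
  refine ⟨fun u v => rank u < rank v, ?_, fun p => (φ p).1, fun p => (φ p).2, ?_⟩
  · exact
      { trichotomous := fun u v h1 h2 => hinj (le_antisymm (not_lt.1 h2) (not_lt.1 h1))
        irrefl := fun u => lt_irrefl _
        trans := fun u v w => lt_trans }
  · rintro u v w huv hvw ⟨i₀, j₀, -, he⟩
    have h0 : (0 : Fin (k + 1)) ∈ ({u, v, w} : Finset _) := by rw [he]; simp
    have hc : ∀ i : Fin k, φ s(i.succ, 0) = Sum.elim id id (s i) := fun i => by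
      rw [Sym2.eq_swap]; exact hcenter _ i rfl
    have hc' : ∀ i : Fin k, φ s(0, i.succ) = Sum.elim id id (s i) := fun i => hcenter _ i rfl
    have hleft : ∀ i : Fin k, rank i.succ < k → ∃ x, s i = .inl x := by
      intro i h
      rw [rankS] at h
      rcases hi : s i with x | x
      · exact ⟨x, rfl⟩
      · simp only [hi, Sum.isLeft_inr, Bool.false_eq_true, if_false] at h
        omega
    have hright : ∀ i : Fin k, k < rank i.succ → ∃ x, s i = .inr x := by
      intro i h
      rw [rankS] at h
      rcases hi : s i with x | x
      · simp only [hi, Sum.isLeft_inl] at h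
        have := i.2
        simp only [if_true] at h
        omega
      · exact ⟨x, rfl⟩
    rcases Fin.eq_zero_or_eq_succ u with rfl | ⟨a, rfl⟩
    · obtain ⟨b, rfl⟩ := (Fin.eq_zero_or_eq_succ v).resolve_left fun h => by simp [h] at huv
      obtain ⟨c, rfl⟩ := (Fin.eq_zero_or_eq_succ w).resolve_left fun h =>
        absurd (huv.trans hvw) (by simp [h])
      obtain ⟨y, hy⟩ := hright b huv
      obtain ⟨z, hz⟩ := hright c (huv.trans hvw)
      have := hleaf _ b c rfl hvw
      rw [hy, hz] at this
      simpa [hc', hy, hz, starWitness, Palette.Rel] using this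
    · rcases Fin.eq_zero_or_eq_succ v with rfl | ⟨b, rfl⟩
      · obtain ⟨c, rfl⟩ := (Fin.eq_zero_or_eq_succ w).resolve_left fun h => by simp [h] at hvw
        obtain ⟨y, hy⟩ := hleft a huv
        obtain ⟨z, hz⟩ := hright c hvw
        have := hleaf _ a c rfl (huv.trans hvw)
        rw [hy, hz] at this
        simpa [hc, hc', hy, hz, starWitness, Palette.Rel] using this
      · have hw0 : w = 0 := by
          simp only [mem_insert, mem_singleton] at h0
          rcases h0 with h | h | h
          · exact absurd h.symm (Fin.succ_ne_zero a)
          · exact absurd h.symm (Fin.succ_ne_zero b)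
          · exact h.symm
        subst hw0
        obtain ⟨y, hy⟩ := hleft a (huv.trans hvw)
        obtain ⟨z, hz⟩ := hleft b hvw
        have := hleaf _ a b rfl huv
        rw [hy, hz] at this
        simpa [hc, hy, hz, starWitness, Palette.Rel] using this

theorem Palette.density_eq_tripleSum (P : Palette ℕ) :
    P.density = tripleSum (tripleInd P.Rel) fun _ => (P.colors.card : ℝ)⁻¹ := by
  have hcard : ∑ a : P.colors, ∑ b : P.colors, ∑ c : P.colors, tripleInd P.Rel a b c
      = P.triples.card := by
    calc _ = ∑ a ∈ P.colors, ∑ b ∈ P.colors, ∑ c ∈ P.colors,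
          if (a, b, c) ∈ P.triples then (1 : ℝ) else 0 := by
          rw [← sum_coe_sort P.colors]
          refine sum_congr rfl fun a _ => ?_
          rw [← sum_coe_sort P.colors]
          refine sum_congr rfl fun b _ => ?_
          rw [← sum_coe_sort P.colors]
          refine sum_congr rfl fun c _ => ?_
          simp only [tripleInd, Palette.Rel]
          congr
      _ = ∑ t ∈ P.colors ×ˢ P.colors ×ˢ P.colors, if t ∈ P.triples then (1 : ℝ) else 0 := by
          simp only [sum_product]
      _ = P.triples.card := by
          rw [sum_ite_mem, inter_eq_right.2 P.triples_sub]
          simp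
  simp only [tripleSum, ← sum_mul]
  rw [hcard, Palette.density, div_eq_mul_inv]
  congr 1
  rw [← inv_pow]
  ring

theorem Palette.density_le_of_not_admits {k n : ℕ} (hk : k = n + 1) (hn : 47 ≤ n)
    (P : Palette ℕ) (hP : ¬ P.Admits (starEdges k)) :
    P.density ≤ 1 - 3 / n + 3 / (n : ℝ) ^ 2 := by
  have : Nonempty P.colors := P.nonempty.to_subtype
  have hfree : ∀ l : List (P.colors ⊕ P.colors), l.Pairwise (starRel P.Rel) → l.length ≤ n := by
    intro l hl
    by_contra! h
    refine hP ?_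
    have := P.admits_of_pairwise_starRel (hl.sublist (List.take_sublist k l))
    rwa [List.length_take, min_eq_left (by omega)] at this
  rw [P.density_eq_tripleSum]
  refine tripleSum_le_of_starRel hn (fun v hv => ?_) hfree ⟨fun _ => by positivity, ?_⟩
  · have := hfree (List.replicate k v) (List.pairwise_replicate.2 (Or.inr hv))
    rw [List.length_replicate] at this
    omega
  · have : (P.colors.card : ℝ) ≠ 0 := by exact_mod_cast P.nonempty.card_pos.ne'
    simp [this]

/-- The extremal palette: triples `(a, b, c)` modulo `n` with `a ≠ b`, `b ≠ c`, `c ≠ a + 1`. -/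
def cyclicPalette (n : ℕ) (hn : 0 < n) : Palette ℕ where
  colors := range n
  nonempty := nonempty_range_iff.2 hn.ne'
  triples := (range n ×ˢ range n ×ˢ range n).filter
    fun t => t.1 ≠ t.2.1 ∧ t.2.1 ≠ t.2.2 ∧ t.2.2 ≠ (t.1 + 1) % n
  triples_sub := filter_subset _ _

theorem cyclicPalette_not_admits (n : ℕ) (hn : 0 < n) :
    ¬ (cyclicPalette n hn).Admits (starEdges (n + 1)) := by
  classical
  rintro ⟨r, hr, φ, hφ, hE⟩
  have hφ' : ∀ p, φ p < n := fun p => mem_range.1 (hφ p)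
  have hE' : ∀ u v w, r u v → r v w → ({u, v, w} : Finset (Fin (n + 1 + 1))) ∈ starEdges (n + 1) →
      φ s(u, v) ≠ φ s(u, w) ∧ φ s(u, w) ≠ φ s(v, w) ∧ φ s(v, w) ≠ (φ s(u, v) + 1) % n :=
    fun u v w h1 h2 h3 => (mem_filter.1 (hE u v w h1 h2 h3)).2
  set f : Fin (n + 1) → ℕ := fun i =>
    if r i.succ 0 then (φ s(0, i.succ) + 1) % n else φ s(0, i.succ) with hf
  have hmaps : ∀ i ∈ (univ : Finset (Fin (n + 1))), f i ∈ range n := by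
    intro i _
    simp only [hf, mem_range]
    split_ifs
    · exact Nat.mod_lt _ hn
    · exact hφ' _
  have hne : ∀ i j : Fin (n + 1), r i.succ j.succ → f i ≠ f j := by
    intro i j hij heq
    have hij' : i ≠ j := by
      rintro rfl
      exact hr.irrefl _ hij
    have hmod : ∀ a b, a < n → b < n → (a + 1) % n = (b + 1) % n → a = b := by
      intro a b ha hb h
      exact Nat.ModEq.eq_of_lt_of_lt (Nat.ModEq.add_right_cancel' 1 h) ha hb
    have htot : ∀ i : Fin (n + 1), ¬ r i.succ 0 → r 0 i.succ := by
      intro i h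
      by_contra h'
      exact Fin.succ_ne_zero i (hr.trichotomous _ _ h h')
    simp only [hf] at heq
    split_ifs at heq with hi hj hj
    · have := hE' _ _ _ hij hj ⟨i, j, hij', by ext; simp; tauto⟩
      rw [Sym2.eq_swap (a := i.succ) (b := 0), Sym2.eq_swap (a := j.succ) (b := 0)] at this
      exact this.2.1 (hmod _ _ (hφ' _) (hφ' _) heq)
    · have := hE' _ _ _ hi (htot j hj) ⟨i, j, hij', by ext; simp; tauto⟩
      rw [Sym2.eq_swap (a := i.succ) (b := 0)] at this
      exact this.2.2 heq.symm
    · exact hi (hr.trans _ _ _ hij hj)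
    · have := hE' _ _ _ (htot i hi) hij ⟨i, j, hij', by ext; simp⟩
      exact this.1 heq
  obtain ⟨i, -, j, -, hij, heq⟩ :=
    exists_ne_map_eq_of_card_lt_of_maps_to (by simp) hmaps
  by_cases h : r i.succ j.succ
  · exact hne i j h heq
  · by_cases h' : r j.succ i.succ
    · exact hne j i h' heq.symm
    · exact hij (Fin.succ_injective _ (hr.trichotomous _ _ h h'))

theorem cyclicPalette_card_triples (n : ℕ) (hn : 2 ≤ n) :
    ((cyclicPalette n (by omega)).triples.card : ℝ) = n * (n ^ 2 - 3 * n + 3) := by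
  have hcount : ∀ a ∈ range n, ∀ c ∈ range n, (∑ b ∈ range n,
      if a ≠ b ∧ b ≠ c ∧ c ≠ (a + 1) % n then (1 : ℝ) else 0)
      = (n - 2) + (if a = c then 1 else 0) - (if (a + 1) % n = c then (n - 2 : ℝ) else 0) := by
    intro a ha c hc
    have hsucc : (a + 1) % n ≠ a := by
      rw [mem_range] at ha
      rcases Nat.lt_or_ge (a + 1) n with h | h
      · rw [Nat.mod_eq_of_lt h]; omega
      · rw [show a + 1 = n by omega, Nat.mod_self]; omega
    by_cases h : (a + 1) % n = c
    · have : a ≠ c := fun h' => hsucc (h.trans h'.symm)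
      simp [h, this]
    · have h1 : ∀ b, (a ≠ b ∧ b ≠ c ∧ c ≠ (a + 1) % n) ↔ b ∉ ({a, c} : Finset ℕ) := by
        intro b
        simp only [mem_insert, mem_singleton, not_or]
        exact ⟨fun h' => ⟨h'.1.symm, h'.2.1⟩, fun h' => ⟨Ne.symm h'.1, h'.2, Ne.symm h⟩⟩
      simp only [h1]
      rw [← sum_filter, filter_notMem_eq_sdiff, sum_const, nsmul_eq_mul, mul_one,
        cast_card_sdiff (insert_subset ha (singleton_subset_iff.2 hc)), card_range]
      by_cases hac : a = c
      · subst hac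
        simp [h]
        ring
      · simp [hac, h, card_pair hac]
  have : ((cyclicPalette n (by omega)).triples.card : ℝ) = ∑ a ∈ range n, ∑ c ∈ range n,
      ∑ b ∈ range n, if a ≠ b ∧ b ≠ c ∧ c ≠ (a + 1) % n then (1 : ℝ) else 0 := by
    rw [cyclicPalette, card_filter]
    push_cast
    rw [sum_product]
    refine sum_congr rfl fun a _ => ?_
    rw [sum_product, sum_comm]
  rw [this, sum_congr rfl fun a ha => sum_congr rfl fun c hc => hcount a ha c hc]
  have hin : ∀ a ∈ range n, ∑ c ∈ range n, (((n : ℝ) - 2) + (if a = c then 1 else 0)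
      - (if (a + 1) % n = c then (n - 2 : ℝ) else 0)) = n ^ 2 - 3 * n + 3 := by
    intro a ha
    have hm : (a + 1) % n < n := Nat.mod_lt _ (by omega)
    rw [sum_sub_distrib, sum_add_distrib, sum_ite_eq, sum_ite_eq, if_pos ha,
      if_pos (mem_range.2 hm), sum_const, card_range, nsmul_eq_mul]
    ring
  rw [sum_congr rfl hin, sum_const, card_range, nsmul_eq_mul]

/-- The supremum of densities of palettes not admitted by the `k`-star equals
`(k² − 5k + 7)/(k − 1)²` for all `k ≥ 48`. -/
theorem star_palette_turan_density (k : ℕ) (hk : 48 ≤ k) :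
    sSup {d : ℝ | ∃ P : Palette ℕ, ¬ P.Admits (starEdges k) ∧ d = P.density} =
      ((k : ℝ) ^ 2 - 5 * k + 7) / ((k : ℝ) - 1) ^ 2 := by
  obtain ⟨n, rfl⟩ : ∃ n, k = n + 1 := ⟨k - 1, by omega⟩
  have hn0 : (n : ℝ) ≠ 0 := by
    have : n ≠ 0 := by omega
    exact_mod_cast this
  have hval : (((n + 1 : ℕ) : ℝ) ^ 2 - 5 * (n + 1 : ℕ) + 7) / (((n + 1 : ℕ) : ℝ) - 1) ^ 2
      = 1 - 3 / n + 3 / (n : ℝ) ^ 2 := by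
    push_cast
    rw [add_sub_cancel_right]
    field_simp
    ring
  rw [hval]
  refine IsGreatest.csSup_eq ⟨⟨_, cyclicPalette_not_admits n (by omega), ?_⟩, ?_⟩
  · rw [Palette.density, cyclicPalette_card_triples n (by omega)]
    simp only [cyclicPalette, card_range]
    field_simp
  · rintro d ⟨P, hP, rfl⟩
    exact P.density_le_of_not_admits rfl (by omega) hP
end

section
/- For every integer k ≥ 48, every palette P with density d(P) > (k² − 5k + 7)/(k − 1)² is admitted by the k-star S_k. -/
/-- One-variable potential whose sum over two vertices bounds `2xy(1 - ea - eb)` from below. -/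
noncomputable def pairPotential (e x a : ℝ) : ℝ :=
  (1 - 2 * e) * (4 * x - x ^ 2 - 2) - 2 * e * x * (a - 1) - 4 * e * x * ((a - 1) ^ 2 / a)
    - e * (x - 1) ^ 2

theorem mul_sub_one_mul_sub_one_le {x y a : ℝ} (hx0 : 0 ≤ x) (hx : x ≤ 2)
    (hy : y ≤ 2) (ha : 0 < a) :
    x * ((y - 1) * (a - 1)) ≤ 2 * x * ((a - 1) ^ 2 / a) + (y - 1) ^ 2 / 2 := by
  have key : (y - 1) * (a - 1) ≤ 2 * ((a - 1) ^ 2 / a) + (y - 1) ^ 2 / 4 := by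
    rw [← sub_nonneg]
    have : 2 * ((a - 1) ^ 2 / a) + (y - 1) ^ 2 / 4 - (y - 1) * (a - 1)
        = (2 * (a - 1) ^ 2 + a * (y - 1) ^ 2 / 4 - a * ((y - 1) * (a - 1))) / a := by
      field_simp
    rw [this]
    apply div_nonneg _ ha.le
    rcases le_total a 2 with h | h
    · nlinarith [sq_nonneg (2 * (a - 1) - a / 2 * (y - 1)),
        mul_nonneg (mul_nonneg ha.le (sub_nonneg.2 h)) (sq_nonneg (y - 1))]
    · nlinarith [mul_nonneg (mul_nonneg ha.le (by linarith : 0 ≤ a - 1)) (by linarith : 0 ≤ 2 - y),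
        mul_nonneg (by linarith : 0 ≤ a - 1) (by linarith : 0 ≤ a - 2),
        mul_nonneg ha.le (sq_nonneg (y - 1))]
  have := mul_le_mul_of_nonneg_left key hx0
  nlinarith [mul_nonneg (sub_nonneg.2 hx) (sq_nonneg (y - 1))]

theorem pairPotential_add_le {e x y a b : ℝ} (he0 : 0 ≤ e) (he : e ≤ 1 / 47) (hx0 : 0 ≤ x)
    (hx : x ≤ 2) (hy0 : 0 ≤ y) (hy : y ≤ 2) (ha : 0 < a) (hb : 0 < b) :
    pairPotential e x a + pairPotential e y b ≤ 2 * (x * y * (1 - e * a - e * b)) := by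
  have h1 := mul_le_mul_of_nonneg_left (mul_sub_one_mul_sub_one_le hx0 hx hy ha) he0
  have h2 := mul_le_mul_of_nonneg_left (mul_sub_one_mul_sub_one_le hy0 hy hx hb) he0
  have h3 := mul_nonneg (by linarith : 0 ≤ 1 - 2 * e) (sq_nonneg (x + y - 2))
  unfold pairPotential
  nlinarith

theorem sub_one_add_sq_div {a : ℝ} (ha : 0 < a) :
    -(1 : ℝ) / 2 ≤ (a - 1) + 2 * ((a - 1) ^ 2 / a) := by
  have : (a - 1) + 2 * ((a - 1) ^ 2 / a) + 1 / 2 = (3 * a ^ 2 - 9 / 2 * a + 2) / a := by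
    field_simp; ring
  have h : 0 ≤ (3 * a ^ 2 - 9 / 2 * a + 2) / a :=
    div_nonneg (by nlinarith [sq_nonneg (a - 3 / 4)]) ha.le
  linarith

theorem pairPotential_le_two {e x a : ℝ} (he0 : 0 ≤ e) (he : e ≤ 1 / 47) (hx0 : 0 ≤ x)
    (ha : 0 < a) : pairPotential e x a ≤ 2 := by
  have h := mul_le_mul_of_nonneg_left (sub_one_add_sq_div ha) (mul_nonneg he0 hx0)
  unfold pairPotential
  nlinarith [mul_nonneg he0 (sq_nonneg (x - 1)),
    mul_nonneg (by linarith : 0 ≤ 1 - 2 * e) (sq_nonneg (x - 2))]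

/-- The Lagrangian of the optimisation problem, at a single vertex. -/
theorem vertex_lagrangian_ge {e t a : ℝ} (he0 : 0 < e) (he : e ≤ 1 / 47) (ht : 0 < t)
    (ht' : e * t ≤ 1) (ha : 0 < a) :
    (3 - 3 * e) / 2 ≤ t - e * (t - 1 / 2) - e / 2 * (t - 1) ^ 2 - 3 * e * t
      + pairPotential e (min t 2) a / t / 2 + (3 / 2 - 5 * e) * (1 / t - 1) + 3 * e * a
      + 2 * e * (1 / a - 1) := by
  have hq : (a - 1) ^ 2 / a = a - 2 + 1 / a := by field_simp; ring
  rcases le_total t 2 with h | h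
  · rw [min_eq_left h]
    have : t - e * (t - 1 / 2) - e / 2 * (t - 1) ^ 2 - 3 * e * t
      + pairPotential e t a / t / 2 + (3 / 2 - 5 * e) * (1 / t - 1) + 3 * e * a
      + 2 * e * (1 / a - 1) - (3 - 3 * e) / 2
      = (1 / 2 - 3 * e - e / 2 - e / 2 * t) * ((t - 1) ^ 2 / t) := by
      unfold pairPotential
      field_simp
      ring
    have h2 : 0 ≤ (1 / 2 - 3 * e - e / 2 - e / 2 * t) * ((t - 1) ^ 2 / t) :=
      mul_nonneg (by nlinarith) (by positivity)
    linarith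
  · rw [min_eq_right h]
    have h1 := sub_one_add_sq_div ha
    have hθ : 0 ≤ 1 - 2 / t := by rw [sub_nonneg, div_le_one ht]; exact h
    have hθ1 : 0 < 2 / t := by positivity
    have h2 := mul_le_mul_of_nonneg_left h1 (mul_nonneg he0.le hθ)
    have h3 : pairPotential e 2 a / t / 2
        = (1 - 5 / 2 * e) / t - 2 / t * (e * ((a - 1) + 2 * ((a - 1) ^ 2 / a))) := by
      unfold pairPotential
      field_simp
      ring
    rw [h3]
    have h4 : 3 * e * a + 2 * e * (1 / a - 1)
        = 3 * e + e * ((a - 1) + 2 * ((a - 1) ^ 2 / a)) := by rw [hq]; ring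
    have h5 : e * (1 - 2 / t) ≤ e := by nlinarith
    suffices (3 - 3 * e) / 2 ≤ t - e * (t - 1 / 2) - e / 2 * (t - 1) ^ 2 - 3 * e * t
        + (1 - 5 / 2 * e) / t + (3 / 2 - 5 * e) * (1 / t - 1) + 3 * e - e / 2 by
      nlinarith
    have h6 : (1 - 5 / 2 * e) / t + (3 / 2 - 5 * e) * (1 / t - 1)
      = (5 / 2 - 15 / 2 * e) / t - (3 / 2 - 5 * e) := by field_simp; ring
    have h7 : (5 / 2 - 15 / 2 * e) * (1 - t / 4) ≤ (5 / 2 - 15 / 2 * e) / t := by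
      rw [div_eq_mul_inv _ t]
      apply mul_le_mul_of_nonneg_left _ (by linarith)
      rw [← one_div, le_div_iff₀ ht]
      nlinarith [sq_nonneg (t - 2)]
    have h8 : (5 / 2 - 15 / 2 * e) / t ≥ 0 := div_nonneg (by linarith) ht.le
    rcases le_total t 4 with h4 | h4
    · nlinarith [mul_nonneg he0.le (mul_nonneg (sub_nonneg.2 h) (sub_nonneg.2 h4))]
    · nlinarith [mul_nonneg (sub_nonneg.2 ht') (sub_nonneg.2 h)]

theorem sum_mul_ge_of_le_two {ι : Type*} [Fintype ι] {f r g : ι → ℝ}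
    (hf : ∀ v, f v ≤ 2) (hr : ∀ v, r v ≤ g v) :
    ∑ v, f v * g v - 2 * (∑ v, g v - ∑ v, r v) ≤ ∑ v, f v * r v := by
  rw [← Finset.sum_sub_distrib, Finset.mul_sum, ← Finset.sum_sub_distrib]
  exact Finset.sum_le_sum fun v _ => by nlinarith [hf v, hr v]

/-- The optimisation problem behind the main theorem: `t, a` and `s, b` are rescaled degree
sequences and `G` is a rescaled fractional matching. -/
theorem density_optimisation {ι : Type*} [Fintype ι] {e : ℝ} (he0 : 0 < e) (he : e ≤ 1 / 47)
    {t s a b : ι → ℝ} {G : ι → ι → ℝ}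
    (ht : ∀ v, 0 < t v) (hs : ∀ v, 0 < s v) (ha : ∀ v, 0 < a v) (hb : ∀ v, 0 < b v)
    (ht1 : ∀ v, e * t v ≤ 1) (hs1 : ∀ v, e * s v ≤ 1)
    (hG : ∀ v w, 0 ≤ G v w)
    (htn : ∑ v, 1 / t v ≤ Fintype.card ι) (hsn : ∑ v, 1 / s v ≤ Fintype.card ι)
    (han : ∑ v, 1 / a v ≤ Fintype.card ι) (hbn : ∑ v, 1 / b v ≤ Fintype.card ι)
    (has : ∑ v, a v = ∑ v, s v) (hbt : ∑ v, b v = ∑ v, t v)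
    (hrow : ∀ v, ∑ w, G v w ≤ Fintype.card ι * (1 / t v))
    (hcol : ∀ w, ∑ v, G v w ≤ Fintype.card ι * (1 / s w))
    (hsum : Fintype.card ι * (∑ v, 1 / t v + ∑ v, 1 / s v - Fintype.card ι) ≤ ∑ v, ∑ w, G v w) :
    (Fintype.card ι : ℝ) ^ 2 * (3 - 3 * e) ≤
      Fintype.card ι * ∑ v, (s v + t v - e * (s v * t v))
        + ∑ v, ∑ w, G v w * (min (t v) 2 * min (s w) 2 * (1 - e * a v - e * b w)) := by
  set n : ℝ := ((Fintype.card ι : ℕ) : ℝ) with hn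
  have hn0 : 0 ≤ n := by positivity
  have hpt0 : ∀ v, 0 ≤ min (t v) 2 := fun v => le_min (ht v).le (by norm_num)
  have hps0 : ∀ v, 0 ≤ min (s v) 2 := fun v => le_min (hs v).le (by norm_num)
  have h1 : ∑ v, pairPotential e (min (t v) 2) (a v) * ∑ w, G v w
      + ∑ w, pairPotential e (min (s w) 2) (b w) * ∑ v, G v w
      ≤ 2 * ∑ v, ∑ w, G v w * (min (t v) 2 * min (s w) 2 * (1 - e * a v - e * b w)) := by
    simp only [Finset.mul_sum]
    rw [Finset.sum_comm (f := fun w v => pairPotential e (min (s w) 2) (b w) * G v w),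
      ← Finset.sum_add_distrib]
    refine Finset.sum_le_sum fun v _ => ?_
    rw [← Finset.sum_add_distrib]
    refine Finset.sum_le_sum fun w _ => ?_
    have := mul_le_mul_of_nonneg_left (pairPotential_add_le he0.le he (hpt0 v) (min_le_right _ _)
      (hps0 w) (min_le_right _ _) (ha v) (hb w)) (hG v w)
    linarith
  have h2 := sum_mul_ge_of_le_two
    (fun v => pairPotential_le_two he0.le he (hpt0 v) (ha v)) hrow
  have h3 := sum_mul_ge_of_le_two
    (fun v => pairPotential_le_two he0.le he (hps0 v) (hb v)) hcol
  rw [Finset.sum_comm (f := fun w v => G v w)] at h3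
  rw [← Finset.mul_sum] at h2 h3
  have h4 : ∀ v, 3 - 3 * e ≤ s v + t v - e * (s v * t v) - 3 * e * t v - 3 * e * s v
      + 3 * e * a v + 3 * e * b v
      + pairPotential e (min (t v) 2) (a v) * (1 / t v) / 2
      + pairPotential e (min (s v) 2) (b v) * (1 / s v) / 2
      + (3 / 2 - 5 * e) * (1 / t v - 1) + (3 / 2 - 5 * e) * (1 / s v - 1)
      + 2 * e * (1 / a v - 1) + 2 * e * (1 / b v - 1) := by
    intro v
    have l1 := vertex_lagrangian_ge he0 he (ht v) (ht1 v) (ha v)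
    have l2 := vertex_lagrangian_ge he0 he (hs v) (hs1 v) (hb v)
    rw [div_eq_mul_one_div (pairPotential _ _ _) (t v)] at l1
    rw [div_eq_mul_one_div (pairPotential _ _ _) (s v)] at l2
    nlinarith [mul_nonneg he0.le (sq_nonneg (s v - t v)),
      mul_nonneg he0.le (sq_nonneg (s v + t v - 2))]
  have h5 := Finset.sum_le_sum fun v (_ : v ∈ Finset.univ) => h4 v
  simp only [Finset.sum_add_distrib, Finset.sum_sub_distrib, ← Finset.mul_sum,
    ← Finset.sum_div, Finset.sum_const, Finset.card_univ, nsmul_eq_mul, ← hn, has, hbt] at h5 ⊢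
  have h6 : ∀ f g : ι → ℝ, ∑ v, f v * (n * g v) = n * ∑ v, f v * g v := fun f g => by
    rw [Finset.mul_sum]; exact Finset.sum_congr rfl fun v _ => by ring
  rw [h6] at h2 h3
  have h7 := mul_le_mul_of_nonneg_left h5 hn0
  have k1 := mul_nonneg hn0 (mul_nonneg (by linarith : 0 ≤ 1 / 2 - 5 * e) (sub_nonneg.2 htn))
  have k2 := mul_nonneg hn0 (mul_nonneg (by linarith : 0 ≤ 1 / 2 - 5 * e) (sub_nonneg.2 hsn))
  have k3 := mul_nonneg hn0 (mul_nonneg he0.le (sub_nonneg.2 han))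
  have k4 := mul_nonneg hn0 (mul_nonneg he0.le (sub_nonneg.2 hbn))
  nlinarith

/-- `density_optimisation` for degree sequences that are not rescaled. -/
theorem degree_sum_optimisation {ι : Type*} [Fintype ι] [Nonempty ι] {m : ℝ} (hm : 47 ≤ m)
    {t s a b : ι → ℝ} {H J : ι → ι → ℝ}
    (ht : ∀ v, 0 < t v) (hs : ∀ v, 0 < s v) (ha : ∀ v, 0 < a v) (hb : ∀ v, 0 < b v)
    (htle : ∀ v, t v ≤ Fintype.card ι) (hsle : ∀ v, s v ≤ Fintype.card ι)
    (hH0 : ∀ v w, 0 ≤ H v w)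
    (htm : ∑ v, 1 / t v ≤ m) (hsm : ∑ v, 1 / s v ≤ m)
    (ham : ∑ v, 1 / a v ≤ m) (hbm : ∑ v, 1 / b v ≤ m)
    (hsa : ∑ v, a v = ∑ v, s v) (hbt : ∑ v, b v = ∑ v, t v)
    (hHrow : ∀ v, ∑ w, H v w ≤ 1 / t v) (hHcol : ∀ w, ∑ v, H v w ≤ 1 / s w)
    (hHsum : ∑ v, 1 / t v + ∑ w, 1 / s w - m ≤ ∑ v, ∑ w, H v w)
    (hHJ : ∀ v w, H v w * (t v * s w) ≤ J v w) :
    (Fintype.card ι : ℝ) ^ 3 * (3 / m - 3 / m ^ 2) ≤ (Fintype.card ι : ℝ) ^ 3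
      - ∑ y, ((Fintype.card ι : ℝ) - s y) * ((Fintype.card ι : ℝ) - t y)
      + ∑ x, ∑ z, J x z * max 0 ((Fintype.card ι : ℝ) - a x - b z) := by
  set n : ℝ := ((Fintype.card ι : ℕ) : ℝ) with hn
  have hn0 : 0 < n := by
    rw [hn]
    exact_mod_cast Fintype.card_pos
  have hm0 : 0 < m := by linarith
  have hscale : ∀ x : ℝ, 1 / (m / n * x) = n / m * (1 / x) := fun x => by
    simp only [one_div, mul_inv, inv_div]
  have hscale_sum : ∀ N : ι → ℝ, ∑ v, 1 / N v ≤ m → ∑ v, 1 / (m / n * N v) ≤ n := fun N h => by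
    simp only [hscale, ← Finset.mul_sum]
    calc n / m * ∑ v, 1 / N v ≤ n / m * m := by gcongr
      _ = n := by field_simp
  have hfrac : ∀ x : ℝ, 1 / m * (m / n * x) = x / n := fun x => by field_simp
  have hopt := density_optimisation (e := 1 / m) (by positivity)
    (one_div_le_one_div_of_le (by norm_num) hm)
    (t := fun v => m / n * t v) (s := fun v => m / n * s v)
    (a := fun v => m / n * a v) (b := fun v => m / n * b v)
    (G := fun v w => n ^ 2 / m * H v w)
    (fun v => mul_pos (by positivity) (ht v)) (fun v => mul_pos (by positivity) (hs v))
    (fun v => mul_pos (by positivity) (ha v)) (fun v => mul_pos (by positivity) (hb v))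
    (fun v => by rw [hfrac, div_le_one hn0]; exact htle v)
    (fun v => by rw [hfrac, div_le_one hn0]; exact hsle v)
    (fun v w => mul_nonneg (by positivity) (hH0 v w))
    (hscale_sum t htm) (hscale_sum s hsm) (hscale_sum a ham) (hscale_sum b hbm)
    (by rw [← Finset.mul_sum, ← Finset.mul_sum, hsa])
    (by rw [← Finset.mul_sum, ← Finset.mul_sum, hbt])
    (fun v => by
      rw [← Finset.mul_sum, hscale, ← hn]
      calc n ^ 2 / m * ∑ w, H v w ≤ n ^ 2 / m * (1 / t v) := by gcongr; exact hHrow v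
        _ = _ := by ring)
    (fun w => by
      rw [← Finset.mul_sum, hscale, ← hn]
      calc n ^ 2 / m * ∑ v, H v w ≤ n ^ 2 / m * (1 / s w) := by gcongr; exact hHcol w
        _ = _ := by ring)
    (by
      simp only [hscale, ← Finset.mul_sum, ← hn]
      calc _ = n ^ 2 / m * (∑ v, 1 / t v + ∑ w, 1 / s w - m) := by field_simp
        _ ≤ _ := by gcongr)
  simp only [← hn, hfrac] at hopt
  have hone : n * ∑ v, (m / n * s v + m / n * t v - 1 / m * (m / n * s v * (m / n * t v)))
      = m / n * (n ^ 3 - ∑ y, (n - s y) * (n - t y)) := by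
    have : n ^ 3 = ∑ _y : ι, n ^ 2 := by
      rw [Finset.sum_const, Finset.card_univ, nsmul_eq_mul, ← hn]; ring
    rw [this, ← Finset.sum_sub_distrib, Finset.mul_sum, Finset.mul_sum]
    refine Finset.sum_congr rfl fun v _ => ?_
    field_simp
    ring
  have htwo : ∑ v, ∑ w, n ^ 2 / m * H v w * (min (m / n * t v) 2
        * min (m / n * s w) 2 * (1 - a v / n - b w / n))
      ≤ m / n * ∑ x, ∑ z, J x z * max 0 (n - a x - b z) := by
    simp only [Finset.mul_sum]
    refine Finset.sum_le_sum fun v _ => Finset.sum_le_sum fun w _ => ?_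
    have hx0 : 0 ≤ n ^ 2 / m * H v w := mul_nonneg (by positivity) (hH0 v w)
    have ht0 := ht v
    have hs0 := hs w
    have hbd : 1 - a v / n - b w / n ≤ max 0 (n - a v - b w) / n := by
      rw [le_div_iff₀ hn0]
      refine le_trans (le_of_eq ?_) (le_max_right _ _)
      field_simp
    have hmax : 0 ≤ max 0 (n - a v - b w) / n := div_nonneg (le_max_left _ _) hn0.le
    calc n ^ 2 / m * H v w * (min (m / n * t v) 2 * min (m / n * s w) 2
          * (1 - a v / n - b w / n))
        ≤ n ^ 2 / m * H v w * (min (m / n * t v) 2 * min (m / n * s w) 2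
          * (max 0 (n - a v - b w) / n)) := by
          refine mul_le_mul_of_nonneg_left (mul_le_mul_of_nonneg_left hbd ?_) hx0
          exact mul_nonneg (le_min (by positivity) (by norm_num))
            (le_min (by positivity) (by norm_num))
      _ ≤ n ^ 2 / m * H v w * ((m / n * t v) * (m / n * s w)
          * (max 0 (n - a v - b w) / n)) := by
          refine mul_le_mul_of_nonneg_left (mul_le_mul
            (mul_le_mul (min_le_left _ _) (min_le_left _ _)
              (le_min (by positivity) (by norm_num)) (by positivity)) le_rfl hmax (by positivity)) hx0
      _ = m / n * (H v w * (t v * s w) * max 0 (n - a v - b w)) := by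
          field_simp
      _ ≤ m / n * (J v w * max 0 (n - a v - b w)) := by gcongr; exact hHJ v w
  rw [hone] at hopt
  have hfin := hopt.trans (add_le_add_right htwo _)
  rw [← mul_add] at hfin
  have := mul_le_mul_of_nonneg_left hfin (by positivity : 0 ≤ n / m)
  rw [← mul_assoc (n / m) (m / n), div_mul_div_cancel₀ hm0.ne', div_self hn0.ne', one_mul] at this
  have h2 : n / m * (n ^ 2 * (3 - 3 * (1 / m))) = n ^ 3 * (3 / m - 3 / m ^ 2) := by
    field_simp
  linarith

/-- Deficiency form of König's theorem: if every `M`-free pair `X ⊆ L`, `Y ⊆ R` has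
`|X| + |Y| ≤ m`, then `M` contains a matching of size at least `|L| + |R| - m`. -/
theorem exists_matching_of_free_pairs {ι : Type*} [DecidableEq ι] (M : ι → ι → Prop)
    (L R : Finset ι) (m : ℕ)
    (h : ∀ X ⊆ L, ∀ Y ⊆ R, (∀ u ∈ X, ∀ v ∈ Y, ¬ M u v) → X.card + Y.card ≤ m) :
    ∃ F : Finset (ι × ι), (∀ p ∈ F, p.1 ∈ L ∧ p.2 ∈ R ∧ M p.1 p.2) ∧
      (∀ p ∈ F, ∀ q ∈ F, p.1 = q.1 → p = q) ∧ (∀ p ∈ F, ∀ q ∈ F, p.2 = q.2 → p = q) ∧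
      L.card + R.card ≤ F.card + m := by
  classical
  have hR : R.card ≤ m := by simpa using h ∅ (by simp) R subset_rfl (by simp)
  let T : L → Finset (ι ⊕ Fin (m - R.card)) := fun v =>
    (R.filter (M v)).disjSum Finset.univ
  have hall : ∀ s : Finset L, s.card ≤ (s.biUnion T).card := by
    intro s
    rcases s.eq_empty_or_nonempty with rfl | ⟨v₀, hv₀⟩
    · simp
    have hsub : (R.filter fun w => ∃ v ∈ s, M v w).disjSum Finset.univ ⊆ s.biUnion T := by
      intro x hx
      rw [Finset.mem_biUnion]
      rcases x with w | j
      · simp only [Finset.inl_mem_disjSum, Finset.mem_filter] at hx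
        obtain ⟨hw, v, hv, hM⟩ := hx
        exact ⟨v, hv, by simp [T, hw, hM]⟩
      · exact ⟨v₀, hv₀, by simp [T]⟩
    refine le_trans ?_ (Finset.card_le_card hsub)
    rw [Finset.card_disjSum, Finset.card_univ, Fintype.card_fin]
    have := h (s.map (Function.Embedding.subtype _)) (by
        intro x hx
        obtain ⟨y, -, rfl⟩ := Finset.mem_map.1 hx
        exact y.2)
      (R.filter fun w => ¬ ∃ v ∈ s, M v w) (Finset.filter_subset _ _) (by
        intro u hu v hv hM
        obtain ⟨y, hy, rfl⟩ := Finset.mem_map.1 hu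
        exact (Finset.mem_filter.1 hv).2 ⟨y, hy, hM⟩)
    rw [Finset.card_map] at this
    have h2 := Finset.card_filter_add_card_filter_not (s := R) (fun w => ∃ v ∈ s, M v w)
    omega
  obtain ⟨f, hf, hfT⟩ := (Finset.all_card_le_biUnion_card_iff_exists_injective T).1 hall
  let F : Finset (ι × ι) := (L ×ˢ R).filter fun p => ∃ hp : p.1 ∈ L, f ⟨p.1, hp⟩ = Sum.inl p.2
  have hF : ∀ p ∈ F, ∃ hp : p.1 ∈ L, f ⟨p.1, hp⟩ = Sum.inl p.2 := fun p hp =>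
    (Finset.mem_filter.1 hp).2
  refine ⟨F, ?_, ?_, ?_, ?_⟩
  · intro p hp
    obtain ⟨hL, he⟩ := hF p hp
    have := hfT ⟨p.1, hL⟩
    rw [he] at this
    simp only [T, Finset.inl_mem_disjSum, Finset.mem_filter] at this
    exact ⟨hL, this.1, this.2⟩
  · rintro ⟨a, b⟩ hp ⟨a', b'⟩ hq (rfl : a = a')
    obtain ⟨_, he⟩ := hF _ hp
    obtain ⟨_, he'⟩ := hF _ hq
    rw [he] at he'
    simpa using he'
  · rintro ⟨a, b⟩ hp ⟨a', b'⟩ hq (rfl : b = b')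
    obtain ⟨_, he⟩ := hF _ hp
    obtain ⟨_, he'⟩ := hF _ hq
    simpa using hf (he.trans he'.symm)
  · have : L.card ≤ (F.disjSum (Finset.univ : Finset (Fin (m - R.card)))).card := by
      rw [← Finset.card_attach]
      refine Finset.card_le_card_of_injOn
        (fun v => (f v).map (fun w => ((v : ι), w)) id) ?_ ?_
      · intro v _
        have hv := hfT v
        rcases hfv : f v with w | j
        · rw [hfv] at hv
          simp only [T, Finset.inl_mem_disjSum, Finset.mem_filter] at hv
          simp [F, hfv, hv.1]
        · simp [hfv]
      · intro u _ v _ huv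
        rcases hfu : f u with w | j <;> rcases hfv : f v with w' | j' <;>
          simp only [hfu, hfv, Sum.map_inl, Sum.map_inr, reduceCtorEq, Sum.inl.injEq,
            Prod.mk.injEq, Sum.inr.injEq, id] at huv
        · exact Subtype.ext huv.1
        · exact hf (by rw [hfu, hfv, huv])
    rw [Finset.card_disjSum, Finset.card_univ, Fintype.card_fin] at this
    omega

/-- In exactly a `1 / |N|` fraction of all enumerations, `v` comes first among `N ∋ v`. -/
theorem card_enumerations_first_mul_card {ι : Type*} [Fintype ι] [DecidableEq ι] (N : Finset ι)
    {v : ι} (hv : v ∈ N) :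
    (Finset.univ.filter fun π : ι ≃ Fin (Fintype.card ι) =>
        ∀ u ∈ N, u ≠ v → π v < π u).card * N.card
      = Fintype.card (ι ≃ Fin (Fintype.card ι)) := by
  let B : ι → Finset (ι ≃ Fin (Fintype.card ι)) := fun w =>
    Finset.univ.filter fun π => ∀ u ∈ N, u ≠ w → π w < π u
  have hle : ∀ w ∈ N, ∀ w' ∈ N, (B w).card ≤ (B w').card := by
    intro w hw w' hw'
    refine Finset.card_le_card_of_injOn (fun π => (Equiv.swap w w').trans π) ?_ ?_
    · intro π hπ
      simp only [B, Finset.coe_filter, Finset.mem_univ, true_and, Set.mem_ofPred_eq,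
        Equiv.trans_apply, Equiv.swap_apply_right] at hπ ⊢
      intro u hu huw
      rcases eq_or_ne u w with rfl | h
      · rw [Equiv.swap_apply_left]
        exact hπ _ hw' huw.symm
      · rw [Equiv.swap_apply_of_ne_of_ne h huw]
        exact hπ u hu h
    · intro π _ π' _ h
      ext u
      have := DFunLike.congr_fun h (Equiv.swap w w' u)
      simpa using congrArg Fin.val this
  have hdisj : (N : Set ι).PairwiseDisjoint B := by
    intro w hw w' hw' hne
    rw [Function.onFun, Finset.disjoint_left]
    intro π h1 h2
    exact lt_asymm ((Finset.mem_filter.1 h1).2 w' hw' hne.symm)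
      ((Finset.mem_filter.1 h2).2 w hw hne)
  have hunion : N.biUnion B = Finset.univ := by
    ext π
    simp only [Finset.mem_biUnion, Finset.mem_univ, iff_true]
    obtain ⟨w, hw, hmin⟩ := N.exists_min_image π ⟨v, hv⟩
    refine ⟨w, hw, Finset.mem_filter.2 ⟨Finset.mem_univ _, fun u hu hne => ?_⟩⟩
    exact lt_of_le_of_ne (hmin u hu) fun h => hne (π.injective h).symm
  have := Finset.card_biUnion hdisj
  rw [hunion, Finset.card_univ,
    Finset.sum_congr rfl fun w hw => le_antisymm (hle w hw v hv) (hle v hv w hw),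
    Finset.sum_const, smul_eq_mul, mul_comm] at this
  exact this.symm

/-- The elements `v` that precede all other elements of `N v` in the enumeration `π`. -/
def firstElements {ι : Type*} [Fintype ι] [DecidableEq ι] (N : ι → Finset ι)
    (π : ι ≃ Fin (Fintype.card ι)) : Finset ι :=
  Finset.univ.filter fun v => ∀ u ∈ N v, u ≠ v → π v < π u

theorem notMem_of_mem_firstElements {ι : Type*} [Fintype ι] [DecidableEq ι] {N : ι → Finset ι}
    {π : ι ≃ Fin (Fintype.card ι)} {u v : ι} (hv : v ∈ firstElements N π) (h : π u < π v) :
    u ∉ N v := fun hu =>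
  lt_asymm h ((Finset.mem_filter.1 hv).2 u hu fun huv => by subst huv; exact lt_irrefl _ h)

theorem sum_ite_mem_firstElements {ι : Type*} [Fintype ι] [DecidableEq ι] {N : ι → Finset ι}
    {v : ι} (hv : v ∈ N v) :
    ∑ π : ι ≃ Fin (Fintype.card ι), (if v ∈ firstElements N π then (1 : ℝ) else 0)
      = Fintype.card (ι ≃ Fin (Fintype.card ι)) * (1 / (N v).card) := by
  have h := card_enumerations_first_mul_card (N v) hv
  have hN : ((N v).card : ℝ) ≠ 0 := by
    exact_mod_cast (Finset.card_pos.2 ⟨v, hv⟩).ne'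
  rw [Finset.sum_boole, ← h]
  simp only [firstElements, Finset.mem_filter, Finset.mem_univ, true_and]
  push_cast
  field_simp

theorem sum_card_firstElements {ι : Type*} [Fintype ι] [DecidableEq ι] {N : ι → Finset ι}
    (hN : ∀ v, v ∈ N v) :
    ∑ π : ι ≃ Fin (Fintype.card ι), ((firstElements N π).card : ℝ)
      = Fintype.card (ι ≃ Fin (Fintype.card ι)) * ∑ v, 1 / ((N v).card : ℝ) := by
  rw [Finset.mul_sum, ← Finset.sum_congr rfl fun v _ => sum_ite_mem_firstElements (hN v),
    Finset.sum_comm]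
  simp

theorem card_enumerations_pos (ι : Type*) [Fintype ι] [DecidableEq ι] :
    (0 : ℝ) < Fintype.card (ι ≃ Fin (Fintype.card ι)) := by
  have : Nonempty (ι ≃ Fin (Fintype.card ι)) := ⟨Fintype.equivFin ι⟩
  exact_mod_cast Fintype.card_pos

/-- A Caro–Wei type bound. -/
theorem sum_one_div_card_le {ι : Type*} [Fintype ι] [DecidableEq ι] {N : ι → Finset ι}
    (hN : ∀ v, v ∈ N v) {m : ℕ} (h : ∀ π, (firstElements N π).card ≤ m) :
    ∑ v, 1 / ((N v).card : ℝ) ≤ m := by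
  refine le_of_mul_le_mul_left ?_ (card_enumerations_pos ι)
  rw [← sum_card_firstElements hN]
  calc ∑ π : ι ≃ Fin (Fintype.card ι), ((firstElements N π).card : ℝ)
      ≤ ∑ π : ι ≃ Fin (Fintype.card ι), (m : ℝ) :=
        Finset.sum_le_sum fun π _ => by exact_mod_cast h π
    _ = _ := by simp

/-- Averaging the matchings between the first elements of two independent enumerations. -/
theorem exists_fractional_matching {ι : Type*} [Fintype ι] [DecidableEq ι] {N N' : ι → Finset ι}
    (hN : ∀ v, v ∈ N v) (hN' : ∀ v, v ∈ N' v) (M : ι → ι → Prop) {m : ℕ}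
    (h : ∀ π π', ∀ X ⊆ firstElements N π, ∀ Y ⊆ firstElements N' π',
      (∀ u ∈ X, ∀ v ∈ Y, ¬ M u v) → X.card + Y.card ≤ m) :
    ∃ H : ι → ι → ℝ, (∀ v w, 0 ≤ H v w) ∧ (∀ v w, ¬ M v w → H v w = 0) ∧
      (∀ v w, H v w ≤ 1 / (N v).card * (1 / (N' w).card)) ∧
      (∀ v, ∑ w, H v w ≤ 1 / (N v).card) ∧ (∀ w, ∑ v, H v w ≤ 1 / (N' w).card) ∧
      ∑ v, 1 / ((N v).card : ℝ) + ∑ w, 1 / ((N' w).card : ℝ) - m ≤ ∑ v, ∑ w, H v w := by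
  choose F hF hFrow hFcol hFcard using fun π π' => exists_matching_of_free_pairs M
    (firstElements N π) (firstElements N' π') m (h π π')
  set c : ℝ := ((Fintype.card (ι ≃ Fin (Fintype.card ι)) : ℕ) : ℝ) with hc
  have hc0 : 0 < c := card_enumerations_pos ι
  have hcc : 0 < c ^ 2 := by positivity
  have hcu : ∀ x : ℝ, ∑ _π : ι ≃ Fin (Fintype.card ι), x = c * x := fun x => by simp [hc]
  let K : ι → ι → ℝ := fun v w => ∑ π : ι ≃ Fin (Fintype.card ι),
    ∑ π' : ι ≃ Fin (Fintype.card ι), if (v, w) ∈ F π π' then 1 else 0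
  refine ⟨fun v w => K v w / c ^ 2, fun v w => ?_, fun v w hM => ?_, fun v w => ?_, fun v => ?_,
    fun w => ?_, ?_⟩
  · exact div_nonneg (Finset.sum_nonneg fun π _ => Finset.sum_nonneg fun π' _ => by
      split_ifs <;> norm_num) hcc.le
  · have : K v w = 0 := Finset.sum_eq_zero fun π _ => Finset.sum_eq_zero fun π' _ =>
      if_neg fun hvw => hM (hF π π' _ hvw).2.2
    simp [this]
  · rw [div_le_iff₀ hcc]
    calc K v w ≤ ∑ π : ι ≃ Fin (Fintype.card ι), ∑ π' : ι ≃ Fin (Fintype.card ι),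
          (if v ∈ firstElements N π then (1 : ℝ) else 0) *
            (if w ∈ firstElements N' π' then (1 : ℝ) else 0) := by
          refine Finset.sum_le_sum fun π _ => Finset.sum_le_sum fun π' _ => ?_
          by_cases hvw : (v, w) ∈ F π π'
          · have := hF π π' _ hvw
            simp [hvw, this.1, this.2.1]
          · rw [if_neg hvw]
            positivity
      _ = _ := by
          rw [← Finset.sum_mul_sum, sum_ite_mem_firstElements (hN v),
            sum_ite_mem_firstElements (hN' w)]
          ring
  · rw [← Finset.sum_div, div_le_iff₀ hcc]
    calc ∑ w, K v w = ∑ π : ι ≃ Fin (Fintype.card ι), ∑ π' : ι ≃ Fin (Fintype.card ι),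
          ∑ w, if (v, w) ∈ F π π' then (1 : ℝ) else 0 := by
          rw [Finset.sum_comm]
          exact Finset.sum_congr rfl fun π _ => Finset.sum_comm
      _ ≤ ∑ π : ι ≃ Fin (Fintype.card ι), ∑ π' : ι ≃ Fin (Fintype.card ι),
          (if v ∈ firstElements N π then (1 : ℝ) else 0) := by
          refine Finset.sum_le_sum fun π _ => Finset.sum_le_sum fun π' _ => ?_
          rw [Finset.sum_boole]
          split_ifs with hv
          · have : (Finset.univ.filter fun w => (v, w) ∈ F π π').card ≤ 1 :=
              Finset.card_le_one.2 fun w hw w' hw' => congrArg Prod.snd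
                (hFrow π π' _ (Finset.mem_filter.1 hw).2 _ (Finset.mem_filter.1 hw').2 rfl)
            exact_mod_cast this
          · rw [Finset.filter_false_of_mem fun w _ hw => hv (hF π π' _ hw).1]
            simp
      _ = _ := by
          simp only [hcu, ← Finset.mul_sum, sum_ite_mem_firstElements (hN v)]
          ring
  · rw [← Finset.sum_div, div_le_iff₀ hcc]
    calc ∑ v, K v w = ∑ π : ι ≃ Fin (Fintype.card ι), ∑ π' : ι ≃ Fin (Fintype.card ι),
          ∑ v, if (v, w) ∈ F π π' then (1 : ℝ) else 0 := by
          rw [Finset.sum_comm]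
          exact Finset.sum_congr rfl fun π _ => Finset.sum_comm
      _ ≤ ∑ π : ι ≃ Fin (Fintype.card ι), ∑ π' : ι ≃ Fin (Fintype.card ι),
          (if w ∈ firstElements N' π' then (1 : ℝ) else 0) := by
          refine Finset.sum_le_sum fun π _ => Finset.sum_le_sum fun π' _ => ?_
          rw [Finset.sum_boole]
          split_ifs with hw
          · have : (Finset.univ.filter fun v => (v, w) ∈ F π π').card ≤ 1 :=
              Finset.card_le_one.2 fun v hv v' hv' => congrArg Prod.fst
                (hFcol π π' _ (Finset.mem_filter.1 hv).2 _ (Finset.mem_filter.1 hv').2 rfl)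
            exact_mod_cast this
          · rw [Finset.filter_false_of_mem fun v _ hv => hw (hF π π' _ hv).2.1]
            simp
      _ = _ := by
          simp only [hcu, sum_ite_mem_firstElements (hN' w)]
          ring
  · simp only [← Finset.sum_div]
    rw [le_div_iff₀ hcc]
    have hK : ∑ v, ∑ w, K v w = ∑ π : ι ≃ Fin (Fintype.card ι),
        ∑ π' : ι ≃ Fin (Fintype.card ι), ((F π π').card : ℝ) := by
      rw [← Fintype.sum_prod_type' K, Finset.sum_comm]
      refine Finset.sum_congr rfl fun π _ => ?_
      rw [Finset.sum_comm]
      exact Finset.sum_congr rfl fun π' _ => by simp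
    rw [hK]
    calc _ = ∑ π : ι ≃ Fin (Fintype.card ι), ∑ π' : ι ≃ Fin (Fintype.card ι),
          (((firstElements N π).card : ℝ) + (firstElements N' π').card - m) := by
          simp only [Finset.sum_add_distrib, Finset.sum_sub_distrib, hcu, ← Finset.mul_sum,
            sum_card_firstElements hN, sum_card_firstElements hN']
          ring
      _ ≤ _ := by
          refine Finset.sum_le_sum fun π _ => Finset.sum_le_sum fun π' _ => ?_
          have : ((firstElements N π).card : ℝ) + (firstElements N' π').card
            ≤ (F π π').card + m := by exact_mod_cast hFcard π π'
          linarith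

/-- Counting triples that satisfy three relations, via the degrees of the complements. -/
theorem card_triples_le_degree_sum {ι : Type*} [Fintype ι] [DecidableEq ι]
    (D₁ D₂ D₃ : ι → ι → Prop) [DecidableRel D₁] [DecidableRel D₂] [DecidableRel D₃] :
    ((Finset.univ.filter fun p : ι × ι × ι =>
        D₃ p.1 p.2.1 ∧ D₂ p.1 p.2.2 ∧ D₁ p.2.1 p.2.2).card : ℝ)
      + ∑ x, ∑ z, (if D₂ x z then 0 else
          max 0 ((Fintype.card ι : ℝ) - (Finset.univ.filter fun y => ¬ D₃ x y).card
            - (Finset.univ.filter fun y => ¬ D₁ y z).card))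
      ≤ ∑ y, ((Fintype.card ι : ℝ) - (Finset.univ.filter fun x => ¬ D₃ x y).card)
          * ((Fintype.card ι : ℝ) - (Finset.univ.filter fun z => ¬ D₁ y z).card) := by
  have hcompl : ∀ p : ι → Prop, ∀ [DecidablePred p],
      (Fintype.card ι : ℝ) - (Finset.univ.filter fun y => ¬ p y).card
        = ∑ y, if p y then (1 : ℝ) else 0 := by
    intro p _
    have := Finset.card_filter_add_card_filter_not (s := (Finset.univ : Finset ι)) p
    rw [Finset.sum_boole, sub_eq_iff_eq_add, ← Finset.card_univ, ← this]
    push_cast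
    rfl
  have hpair : ∀ x z, max 0 ((Fintype.card ι : ℝ) - (Finset.univ.filter fun y => ¬ D₃ x y).card
      - (Finset.univ.filter fun y => ¬ D₁ y z).card)
      ≤ ∑ y, (if D₃ x y then (1 : ℝ) else 0) * (if D₁ y z then 1 else 0) := by
    intro x z
    refine max_le (Finset.sum_nonneg fun y _ => by positivity) ?_
    rw [hcompl, sub_le_iff_le_add, Finset.card_filter]
    push_cast
    rw [← Finset.sum_add_distrib]
    refine Finset.sum_le_sum fun y _ => ?_
    split_ifs <;> norm_num
  have hcard : ((Finset.univ.filter fun p : ι × ι × ι =>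
        D₃ p.1 p.2.1 ∧ D₂ p.1 p.2.2 ∧ D₁ p.2.1 p.2.2).card : ℝ)
      = ∑ x, ∑ z, (if D₂ x z then
        ∑ y, (if D₃ x y then (1 : ℝ) else 0) * (if D₁ y z then 1 else 0) else 0) := by
    rw [Finset.card_filter]
    push_cast
    rw [Fintype.sum_prod_type]
    refine Finset.sum_congr rfl fun x _ => ?_
    rw [Fintype.sum_prod_type, Finset.sum_comm]
    refine Finset.sum_congr rfl fun z _ => ?_
    by_cases h : D₂ x z
    · simp only [h, true_and, if_true]
      refine Finset.sum_congr rfl fun y _ => ?_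
      split_ifs <;> simp_all
    · simp [h]
  rw [hcard, ← Finset.sum_add_distrib]
  calc _ ≤ ∑ x, ∑ z, ∑ y, (if D₃ x y then (1 : ℝ) else 0) * (if D₁ y z then 1 else 0) := by
        refine Finset.sum_le_sum fun x _ => ?_
        rw [← Finset.sum_add_distrib]
        refine Finset.sum_le_sum fun z _ => ?_
        split_ifs with h
        · simp
        · simpa using hpair x z
    _ = _ := by
        simp only [hcompl, Finset.sum_mul_sum]
        rw [Finset.sum_congr rfl fun x _ => Finset.sum_comm, Finset.sum_comm]

set_option maxHeartbeats 1000000 in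
/-- If transitive sets for `D₁` and `D₃` that are completely joined by `D₂` have total size at
most `m`, then few triples satisfy all three relations. -/
theorem card_triples_le {ι : Type*} [Fintype ι] [DecidableEq ι] [Nonempty ι]
    (D₁ D₂ D₃ : ι → ι → Prop) [DecidableRel D₁] [DecidableRel D₂] [DecidableRel D₃]
    {m : ℕ} (hm : 47 ≤ m) (hirr₁ : ∀ v, ¬ D₁ v v) (hirr₃ : ∀ v, ¬ D₃ v v)
    (key : ∀ f g : ι → ℤ, Function.Injective f → Function.Injective g → ∀ X Y : Finset ι,
      (∀ u ∈ X, ∀ v ∈ X, f u < f v → D₁ u v) → (∀ u ∈ Y, ∀ v ∈ Y, g u < g v → D₃ u v) →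
      (∀ u ∈ X, ∀ v ∈ Y, D₂ u v) → X.card + Y.card ≤ m) :
    ((Finset.univ.filter fun p : ι × ι × ι =>
        D₃ p.1 p.2.1 ∧ D₂ p.1 p.2.2 ∧ D₁ p.2.1 p.2.2).card : ℝ)
      ≤ (Fintype.card ι : ℝ) ^ 3 * (1 - 3 / m + 3 / m ^ 2) := by
  let t : ι → Finset ι := fun y => Finset.univ.filter fun z => ¬ D₁ y z
  let s : ι → Finset ι := fun y => Finset.univ.filter fun x => ¬ D₃ x y
  let a : ι → Finset ι := fun x => Finset.univ.filter fun y => ¬ D₃ x y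
  let b : ι → Finset ι := fun z => Finset.univ.filter fun y => ¬ D₁ y z
  have ht : ∀ v, v ∈ t v := fun v => by simp [t, hirr₁]
  have hs : ∀ v, v ∈ s v := fun v => by simp [s, hirr₃]
  have ha : ∀ v, v ∈ a v := fun v => by simp [a, hirr₃]
  have hb : ∀ v, v ∈ b v := fun v => by simp [b, hirr₁]
  let up : (ι ≃ Fin (Fintype.card ι)) → ι → ℤ := fun π v => ((π v : ℕ) : ℤ)
  let down : (ι ≃ Fin (Fintype.card ι)) → ι → ℤ := fun π v => -((π v : ℕ) : ℤ)
  have hup : ∀ π, Function.Injective (up π) := fun π u v h => by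
    simpa [up, Fin.val_inj] using h
  have hdown : ∀ π, Function.Injective (down π) := fun π u v h => by
    simpa [down, Fin.val_inj] using h
  have tt : ∀ π, ∀ X ⊆ firstElements t π, ∀ u ∈ X, ∀ v ∈ X, down π u < down π v → D₁ u v := by
    intro π X hX u hu v _ h
    have := notMem_of_mem_firstElements (hX hu) (by simpa [down] using h : π v < π u)
    simpa [t] using this
  have ta : ∀ π, ∀ X ⊆ firstElements a π, ∀ u ∈ X, ∀ v ∈ X, down π u < down π v → D₃ u v := by
    intro π X hX u hu v _ h
    have := notMem_of_mem_firstElements (hX hu) (by simpa [down] using h : π v < π u)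
    simpa [a] using this
  have ts : ∀ π, ∀ X ⊆ firstElements s π, ∀ u ∈ X, ∀ v ∈ X, up π u < up π v → D₃ u v := by
    intro π X hX u _ v hv h
    have := notMem_of_mem_firstElements (hX hv) (by simpa [up] using h : π u < π v)
    simpa [s] using this
  have tb : ∀ π, ∀ X ⊆ firstElements b π, ∀ u ∈ X, ∀ v ∈ X, up π u < up π v → D₁ u v := by
    intro π X hX u _ v hv h
    have := notMem_of_mem_firstElements (hX hv) (by simpa [up] using h : π u < π v)
    simpa [b] using this
  have hts := sum_one_div_card_le ht (m := m) fun π => by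
    simpa using key _ _ (hdown π) (hdown π) _ ∅ (tt π _ subset_rfl) (by simp) (by simp)
  have hbs := sum_one_div_card_le hb (m := m) fun π => by
    simpa using key _ _ (hup π) (hup π) _ ∅ (tb π _ subset_rfl) (by simp) (by simp)
  have hss := sum_one_div_card_le hs (m := m) fun π => by
    simpa using key _ _ (hup π) (hup π) ∅ _ (by simp) (ts π _ subset_rfl) (by simp)
  have has := sum_one_div_card_le ha (m := m) fun π => by
    simpa using key _ _ (hdown π) (hdown π) ∅ _ (by simp) (ta π _ subset_rfl) (by simp)
  obtain ⟨H, hH0, hHM, hHle, hHrow, hHcol, hHsum⟩ := exists_fractional_matching ht hs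
    (fun u v => ¬ D₂ u v) (m := m) fun π π' X hX Y hY hXY =>
      key _ _ (hdown π) (hup π') X Y (tt π X hX) (ts π' Y hY)
        fun u hu v hv => not_not.1 (hXY u hu v hv)
  have hcount := card_triples_le_degree_sum D₁ D₂ D₃
  have hsa : ∑ v, ((a v).card : ℝ) = ∑ v, ((s v).card : ℝ) := by
    simp only [a, s, Finset.card_filter]
    push_cast
    exact Finset.sum_comm
  have hbt : ∑ v, ((b v).card : ℝ) = ∑ v, ((t v).card : ℝ) := by
    simp only [b, t, Finset.card_filter]
    push_cast
    exact Finset.sum_comm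
  change _ + ∑ x, ∑ z, (if D₂ x z then 0 else
    max 0 ((Fintype.card ι : ℝ) - (a x).card - (b z).card)) ≤
      ∑ y, ((Fintype.card ι : ℝ) - (s y).card) * ((Fintype.card ι : ℝ) - (t y).card) at hcount
  have hpos : ∀ N : ι → Finset ι, (∀ v, v ∈ N v) → ∀ v, (0 : ℝ) < (N v).card := fun N hN v => by
    exact_mod_cast Finset.card_pos.2 ⟨v, hN v⟩
  have hle : ∀ N : ι → Finset ι, ∀ v, ((N v).card : ℝ) ≤ Fintype.card ι := fun N v => by
    exact_mod_cast Finset.card_le_univ _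
  have hopt := degree_sum_optimisation (m := (m : ℝ)) (by exact_mod_cast hm)
    (J := fun x z => if D₂ x z then 0 else 1) (hpos t ht) (hpos s hs) (hpos a ha) (hpos b hb)
    (hle t) (hle s) hH0 hts hss has hbs hsa hbt hHrow hHcol hHsum (fun v w => by
      have ht0 := hpos t ht v
      have hs0 := hpos s hs w
      split_ifs with hD
      · rw [hHM v w (not_not.2 hD), zero_mul]
      · calc H v w * ((t v).card * (s w).card)
            ≤ 1 / (t v).card * (1 / (s w).card) * ((t v).card * (s w).card) := by
              gcongr; exact hHle v w
          _ = 1 := by field_simp)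
  simp only [ite_mul, zero_mul, one_mul] at hopt
  linarith

/-- A sufficient condition under which the star admits a palette: place the center at `0` and the leaf
`i` at position `pos i`, and give the pair of the center and the leaf `i` the color `col i`. -/
theorem Palette.admits_starEdges_of_positions {α : Type} [DecidableEq α] (P : Palette α) {k : ℕ}
    (pos : Fin k → ℤ) (hpos : Function.Injective pos) (hpos0 : ∀ i, pos i ≠ 0) (col : Fin k → α)
    (hcol : ∀ i, col i ∈ P.colors)
    (h1 : ∀ i j, pos i < pos j → pos j < 0 → ∃ x, (x, col i, col j) ∈ P.triples)
    (h2 : ∀ i j, pos i < 0 → 0 < pos j → ∃ x, (col i, x, col j) ∈ P.triples)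
    (h3 : ∀ i j, 0 < pos i → pos i < pos j → ∃ x, (col i, col j, x) ∈ P.triples) :
    P.Admits (starEdges k) := by
  let q : Fin (k + 1) → ℤ := Fin.cons 0 pos
  have hq0 : q 0 = 0 := rfl
  have hqs : ∀ i : Fin k, q i.succ = pos i := fun i => rfl
  have hq : Function.Injective q :=
    Fin.cons_injective_iff.2 ⟨fun ⟨i, hi⟩ => hpos0 i hi, hpos⟩
  have hleaf : ∀ i j : Fin k, pos i < pos j → ∃ x ∈ P.colors,
      (pos j < 0 → (x, col i, col j) ∈ P.triples) ∧
      (pos i < 0 → 0 < pos j → (col i, x, col j) ∈ P.triples) ∧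
      (0 < pos i → (col i, col j, x) ∈ P.triples) := by
    intro i j hij
    have hmem : ∀ {a b c : α}, (a, b, c) ∈ P.triples →
        a ∈ P.colors ∧ b ∈ P.colors ∧ c ∈ P.colors := fun h => by
      simpa using P.triples_sub h
    rcases lt_or_gt_of_ne (hpos0 j) with hj | hj
    · obtain ⟨x, hx⟩ := h1 i j hij hj
      exact ⟨x, (hmem hx).1, fun _ => hx, fun _ _ => by omega, fun _ => by omega⟩
    · rcases lt_or_gt_of_ne (hpos0 i) with hi | hi
      · obtain ⟨x, hx⟩ := h2 i j hi hj
        exact ⟨x, (hmem hx).2.1, fun _ => by omega, fun _ _ => hx, fun _ => by omega⟩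
      · obtain ⟨x, hx⟩ := h3 i j hi hij
        exact ⟨x, (hmem hx).2.2, fun _ => by omega, fun _ _ => by omega, fun _ => hx⟩
  have hpair : ∀ p : Sym2 (Fin (k + 1)), ∃ x ∈ P.colors,
      (∀ i : Fin k, p = s(0, i.succ) → x = col i) ∧
      ∀ i j : Fin k, p = s(i.succ, j.succ) → pos i < pos j →
        (pos j < 0 → (x, col i, col j) ∈ P.triples) ∧
        (pos i < 0 → 0 < pos j → (col i, x, col j) ∈ P.triples) ∧
        (0 < pos i → (col i, col j, x) ∈ P.triples) := by
    intro p
    by_cases hc : ∃ i : Fin k, p = s(0, i.succ)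
    · obtain ⟨i, rfl⟩ := hc
      refine ⟨col i, hcol i, fun j hj => ?_, fun a b hab => ?_⟩
      · have : i = j := by simpa [Fin.succ_ne_zero, (Fin.succ_ne_zero _).symm] using hj
        rw [this]
      · simp [(Fin.succ_ne_zero _).symm] at hab
    by_cases hl : ∃ i j : Fin k, p = s(i.succ, j.succ) ∧ pos i < pos j
    · obtain ⟨i, j, rfl, hij⟩ := hl
      obtain ⟨x, hx, hx'⟩ := hleaf i j hij
      refine ⟨x, hx, fun l hl => absurd ⟨l, hl⟩ hc, fun a b hab hlt => ?_⟩
      rw [Sym2.eq_iff, Fin.succ_inj, Fin.succ_inj, Fin.succ_inj, Fin.succ_inj] at hab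
      rcases hab with ⟨rfl, rfl⟩ | ⟨rfl, rfl⟩
      · exact hx'
      · exact absurd hij hlt.not_gt
    · obtain ⟨x, hx⟩ := P.nonempty
      exact ⟨x, hx, fun i hi => absurd ⟨i, hi⟩ hc, fun i j h h' => absurd ⟨i, j, h, h'⟩ hl⟩
  choose φ hφ hφc hφl using hpair
  refine ⟨fun u v => q u < q v, ?_, φ, hφ, ?_⟩
  · exact { trichotomous := fun u v h h' => hq (le_antisymm (not_lt.1 h') (not_lt.1 h))
            irrefl := fun u => lt_irrefl _
            trans := fun u v w => lt_trans }
  · intro u v w huv hvw ⟨i, j, hij, he⟩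
    have hz : (0 : Fin (k + 1)) ∈ ({u, v, w} : Finset _) := by rw [he]; simp
    have huv' : u ≠ v := fun h => by subst h; exact lt_irrefl _ huv
    have hvw' : v ≠ w := fun h => by subst h; exact lt_irrefl _ hvw
    have huw' : u ≠ w := fun h => by subst h; exact lt_asymm huv hvw
    simp only [Finset.mem_insert, Finset.mem_singleton] at hz
    rcases hz with rfl | rfl | rfl
    · obtain ⟨v, rfl⟩ := Fin.exists_succ_eq.2 huv'.symm
      obtain ⟨w, rfl⟩ := Fin.exists_succ_eq.2 huw'.symm
      rw [hφc _ v rfl, hφc _ w rfl]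
      rw [hqs, hq0] at huv
      rw [hqs, hqs] at hvw
      exact (hφl _ v w rfl hvw).2.2 huv
    · obtain ⟨u, rfl⟩ := Fin.exists_succ_eq.2 huv'
      obtain ⟨w, rfl⟩ := Fin.exists_succ_eq.2 hvw'.symm
      rw [hφc _ u Sym2.eq_swap, hφc _ w rfl]
      rw [hqs, hq0] at huv hvw
      exact (hφl _ u w rfl (huv.trans hvw)).2.1 huv hvw
    · obtain ⟨u, rfl⟩ := Fin.exists_succ_eq.2 huw'
      obtain ⟨v, rfl⟩ := Fin.exists_succ_eq.2 hvw'
      rw [hφc _ u Sym2.eq_swap, hφc _ v Sym2.eq_swap]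
      rw [hqs, hqs] at huv
      rw [hqs, hq0] at hvw
      exact (hφl _ u v rfl huv).1 hvw

/-- A set of colors ordered for the first coordinate projection and one ordered for the third,
completely joined in the second, give a star on at most as many leaves as there are colors. -/
theorem Palette.admits_starEdges_of_joined {α : Type} [DecidableEq α] (P : Palette α) {k : ℕ}
    (f g : {x // x ∈ P.colors} → ℤ) (hf : Function.Injective f) (hg : Function.Injective g)
    (X Y : Finset {x // x ∈ P.colors})
    (hX : ∀ u ∈ X, ∀ v ∈ X, f u < f v → ∃ x, (x, u.1, v.1) ∈ P.triples)
    (hY : ∀ u ∈ Y, ∀ v ∈ Y, g u < g v → ∃ x, (u.1, v.1, x) ∈ P.triples)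
    (hXY : ∀ u ∈ X, ∀ v ∈ Y, ∃ x, (u.1, x, v.1) ∈ P.triples) (hk : k ≤ X.card + Y.card) :
    P.Admits (starEdges k) := by
  obtain ⟨e⟩ : Nonempty (Fin k ↪ X ⊕ Y) :=
    Function.Embedding.nonempty_of_card_le (by simpa using hk)
  obtain ⟨B, hB⟩ := (Set.finite_range f).bddAbove
  obtain ⟨B', hB'⟩ := (Set.finite_range g).bddBelow
  replace hB : ∀ v, f v ≤ B := fun v => hB ⟨v, rfl⟩
  replace hB' : ∀ v, B' ≤ g v := fun v => hB' ⟨v, rfl⟩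
  let pos : X ⊕ Y → ℤ := Sum.elim (fun u => f u - B - 1) (fun v => g v - B' + 1)
  let col : X ⊕ Y → {x // x ∈ P.colors} := Sum.elim Subtype.val Subtype.val
  have hl : ∀ u : X, pos (.inl u) = f u - B - 1 := fun _ => rfl
  have hr : ∀ v : Y, pos (.inr v) = g v - B' + 1 := fun _ => rfl
  have hl0 : ∀ u : X, pos (.inl u) < 0 := fun u => by rw [hl]; linarith [hB u]
  have hr0 : ∀ v : Y, 0 < pos (.inr v) := fun v => by rw [hr]; linarith [hB' v]
  have hpos : Function.Injective pos := by
    rintro (u | u) (v | v) h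
    · rw [hl, hl] at h
      exact congrArg _ (Subtype.ext (hf (by linarith)))
    · linarith [hl0 u, hr0 v]
    · linarith [hr0 u, hl0 v]
    · rw [hr, hr] at h
      exact congrArg _ (Subtype.ext (hg (by linarith)))
  have h1 : ∀ p q, pos p < pos q → pos q < 0 → ∃ x, (x, (col p).1, (col q).1) ∈ P.triples := by
    rintro (u | u) (v | v) h h'
    · rw [hl, hl] at h
      exact hX u u.2 v v.2 (by linarith)
    · linarith [hr0 v]
    · linarith [hr0 u]
    · linarith [hr0 v]
  have h2 : ∀ p q, pos p < 0 → 0 < pos q → ∃ x, ((col p).1, x, (col q).1) ∈ P.triples := by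
    rintro (u | u) (v | v) h h'
    · linarith [hl0 v]
    · exact hXY u u.2 v v.2
    · linarith [hr0 u]
    · linarith [hr0 u]
  have h3 : ∀ p q, 0 < pos p → pos p < pos q → ∃ x, ((col p).1, (col q).1, x) ∈ P.triples := by
    rintro (u | u) (v | v) h h'
    · linarith [hl0 u]
    · linarith [hl0 u]
    · linarith [hl0 v]
    · rw [hr, hr] at h'
      exact hY u u.2 v v.2 (by linarith)
  refine P.admits_starEdges_of_positions (fun i => pos (e i)) (hpos.comp e.injective) (fun i => ?_)
    (fun i => (col (e i)).1) (fun i => (col (e i)).2) (fun i j => h1 _ _) (fun i j => h2 _ _)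
    (fun i j => h3 _ _)
  rcases e i with u | u
  · exact (hl0 u).ne
  · exact (hr0 u).ne'

/-- The triples of a palette are among those with all three pair projections realised. -/
theorem Palette.card_triples_le_card_filter {α : Type} [DecidableEq α] (P : Palette α)
    (D₁ D₂ D₃ : {x // x ∈ P.colors} → {x // x ∈ P.colors} → Prop)
    [DecidableRel D₁] [DecidableRel D₂] [DecidableRel D₃]
    (h : ∀ x y z, (x.1, y.1, z.1) ∈ P.triples → D₃ x y ∧ D₂ x z ∧ D₁ y z) :
    P.triples.card ≤ (Finset.univ.filter fun p :
      {x // x ∈ P.colors} × {x // x ∈ P.colors} × {x // x ∈ P.colors} =>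
        D₃ p.1 p.2.1 ∧ D₂ p.1 p.2.2 ∧ D₁ p.2.1 p.2.2).card := by
  refine Finset.card_le_card_of_surjOn (fun p => (p.1.1, p.2.1.1, p.2.2.1)) ?_
  rintro ⟨x, y, z⟩ hp
  have hmem : x ∈ P.colors ∧ y ∈ P.colors ∧ z ∈ P.colors := by simpa using P.triples_sub hp
  exact ⟨(⟨x, hmem.1⟩, ⟨y, hmem.2.1⟩, ⟨z, hmem.2.2⟩),
    Finset.mem_coe.2 (Finset.mem_filter.2 ⟨Finset.mem_univ _, h _ _ _ hp⟩), rfl⟩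

/-- For `k ≥ 48`, every palette of density greater than `(k² − 5k + 7)/(k − 1)²`
is admitted by the `k`-star. -/
theorem star_admits_dense_palette (k : ℕ) (hk : 48 ≤ k)
    {α : Type} [DecidableEq α] (P : Palette α)
    (hd : ((k : ℝ) ^ 2 - 5 * k + 7) / ((k : ℝ) - 1) ^ 2 < P.density) :
    P.Admits (starEdges k) := by
  classical
  by_contra hnot
  have : Nonempty {x // x ∈ P.colors} := P.nonempty.to_subtype
  obtain ⟨D₁, hD₁⟩ : ∃ D : {x // x ∈ P.colors} → {x // x ∈ P.colors} → Prop,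
    ∀ y z, D y z ↔ ∃ x, (x, y.1, z.1) ∈ P.triples := ⟨_, fun _ _ => Iff.rfl⟩
  obtain ⟨D₂, hD₂⟩ : ∃ D : {x // x ∈ P.colors} → {x // x ∈ P.colors} → Prop,
    ∀ x z, D x z ↔ ∃ y, (x.1, y, z.1) ∈ P.triples := ⟨_, fun _ _ => Iff.rfl⟩
  obtain ⟨D₃, hD₃⟩ : ∃ D : {x // x ∈ P.colors} → {x // x ∈ P.colors} → Prop,
    ∀ x y, D x y ↔ ∃ z, (x.1, y.1, z) ∈ P.triples := ⟨_, fun _ _ => Iff.rfl⟩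
  have hirr₁ : ∀ v, ¬ D₁ v v := fun v hv =>
    hnot (P.admits_starEdges_of_positions (fun i => -((i : ℕ) : ℤ) - 1)
      (fun i j h => Fin.ext (by simpa using h)) (fun i => by omega) (fun _ => v.1) (fun _ => v.2)
      (fun _ _ _ _ => (hD₁ v v).1 hv) (fun i j _ h => by omega) (fun i j h _ => by omega))
  have hirr₃ : ∀ v, ¬ D₃ v v := fun v hv =>
    hnot (P.admits_starEdges_of_positions (fun i => ((i : ℕ) : ℤ) + 1)
      (fun i j h => Fin.ext (by simpa using h)) (fun i => by omega) (fun _ => v.1) (fun _ => v.2)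
      (fun i j _ h => by omega) (fun i j h _ => by omega) (fun _ _ _ _ => (hD₃ v v).1 hv))
  have hbound := card_triples_le D₁ D₂ D₃ (m := k - 1) (by omega) hirr₁ hirr₃
    fun f g hf hg X Y hX hY hXY => by
      by_contra hcard
      simp only [hD₁, hD₂, hD₃] at hX hY hXY
      exact hnot (P.admits_starEdges_of_joined f g hf hg X Y hX hY hXY (by omega))
  have hcard := (Nat.cast_le (α := ℝ).2 (P.card_triples_le_card_filter D₁ D₂ D₃
    fun x y z h => ⟨(hD₃ _ _).2 ⟨_, h⟩, (hD₂ _ _).2 ⟨_, h⟩, (hD₁ _ _).2 ⟨_, h⟩⟩)).trans hbound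
  rw [Fintype.card_coe, Nat.cast_sub (by omega), Nat.cast_one] at hcard
  have hpos : (0 : ℝ) < (P.colors.card : ℝ) ^ 3 :=
    pow_pos (Nat.cast_pos.2 P.nonempty.card_pos) 3
  have hk1 : (k : ℝ) - 1 ≠ 0 := by
    have : (48 : ℝ) ≤ k := by exact_mod_cast hk
    linarith
  have hval : ((k : ℝ) ^ 2 - 5 * k + 7) / ((k : ℝ) - 1) ^ 2
      = 1 - 3 / ((k : ℝ) - 1) + 3 / ((k : ℝ) - 1) ^ 2 := by
    field_simp
    ring
  rw [hval, Palette.density, lt_div_iff₀ hpos] at hd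
  linarith
end
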